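/- arXiv:1707.07154 — 3 statements merged into one kernel-verified Lean document; each statement's English description precedes it below -/
import Mathlib

section
/- Let d be a natural number that is not a perfect square and m a nonzero integer with |m| < √d. If x and y are nonzero natural numbers that are coprime and satisfy x² − d·y² = m, then x/y is a convergent of √d: there exists n ≥ 0 with x = p_n and y = q_n. -/
/-- The complete quotients of a real number `x`:
`cq x 0 = x` and `cq x (n+1) = 1 / (cq x n - ⌊cq x n⌋)`. -/
noncomputable def cq (x : ℝ) : ℕ → ℝ
  | 0 => x
  | n + 1 => (Int.fract (cq x n))⁻¹

/-- The partial quotients of a real number `x`: `pq x n = ⌊cq x n⌋`. -/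
noncomputable def pq (x : ℝ) (n : ℕ) : ℤ := ⌊cq x n⌋

/-- The sequence `u, v, a 0 * v + u, …` solving `s (n + 2) = a n * s (n + 1) + s n`. -/
def continuantSeq (a : ℕ → ℤ) (u v : ℤ) : ℕ → ℤ
  | 0 => u
  | 1 => v
  | n + 2 => a n * continuantSeq a u v (n + 1) + continuantSeq a u v n

theorem eq_continuantSeq {a s : ℕ → ℤ} (hs : ∀ n, s (n + 2) = a n * s (n + 1) + s n) (n : ℕ) :
    s n = continuantSeq a (s 0) (s 1) n := by
  induction n using Nat.twoStepInduction with
  | zero => rfl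
  | one => rfl
  | more n h₀ h₁ => rw [hs, h₀, h₁, continuantSeq]

/-- Splitting off the first coefficient of a continuant sequence. -/
theorem continuantSeq_succ (a : ℕ → ℤ) (u v : ℤ) (n : ℕ) :
    continuantSeq a u v (n + 1) = continuantSeq (fun i ↦ a (i + 1)) v (a 0 * v + u) n := by
  have h := eq_continuantSeq (a := fun i ↦ a (i + 1))
    (s := fun i ↦ continuantSeq a u v (i + 1)) (fun _ ↦ rfl) n
  simpa [continuantSeq] using h

theorem continuantSeq_eq_add (a : ℕ → ℤ) (u v : ℤ) (n : ℕ) :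
    continuantSeq a u v n = u * continuantSeq a 1 0 n + v * continuantSeq a 0 1 n := by
  induction n using Nat.twoStepInduction with
  | zero => simp [continuantSeq]
  | one => simp [continuantSeq]
  | more n h₀ h₁ => simp only [continuantSeq, h₀, h₁]; ring

theorem continuantSeq_det (a : ℕ → ℤ) (n : ℕ) :
    continuantSeq a 0 1 (n + 1) * continuantSeq a 1 0 n
      - continuantSeq a 0 1 n * continuantSeq a 1 0 (n + 1) = (-1) ^ n := by
  induction n with
  | zero => simp [continuantSeq]
  | succ n ih => rw [pow_succ, ← ih]; simp only [continuantSeq]; ring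

theorem continuantSeq_isCoprime (a : ℕ → ℤ) (n : ℕ) :
    IsCoprime (continuantSeq a 0 1 n) (continuantSeq a 1 0 n) := by
  refine ⟨-(-1) ^ n * continuantSeq a 1 0 (n + 1), (-1) ^ n * continuantSeq a 0 1 (n + 1), ?_⟩
  have hsq : ((-1 : ℤ) ^ n) * (-1) ^ n = 1 := by rw [← mul_pow]; simp
  linear_combination (-1) ^ n * continuantSeq_det a n + hsq

theorem continuantSeq_pos {a : ℕ → ℤ} (ha : ∀ n, 1 ≤ a n) {u v : ℤ} (hu : 0 ≤ u) (hv : 0 < v)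
    (n : ℕ) : 0 < continuantSeq a u v (n + 1) := by
  suffices h : 0 ≤ continuantSeq a u v n ∧ 0 < continuantSeq a u v (n + 1) from h.2
  induction n with
  | zero => exact ⟨hu, hv⟩
  | succ n ih =>
    refine ⟨ih.2.le, ?_⟩
    have := mul_pos (zero_lt_one.trans_le (ha n)) ih.2
    simp only [continuantSeq]
    linarith [ih.1]

theorem continuantSeq_den_pos {a : ℕ → ℤ} (ha : ∀ n, 1 ≤ a n) (n : ℕ) :
    0 < continuantSeq a 1 0 (n + 2) := by
  rw [continuantSeq_succ]
  exact continuantSeq_pos (fun i ↦ ha (i + 1)) le_rfl (by simp) n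

/-- The complete quotients of `ξ` from index one on are those of `1 / fract ξ`. -/
theorem cq_succ_eq_cq_inv_fract (ξ : ℝ) (n : ℕ) : cq ξ (n + 1) = cq (Int.fract ξ)⁻¹ n := by
  induction n with
  | zero => rfl
  | succ n ih => rw [cq, ih, cq]

theorem irrational_inv_fract {ξ : ℝ} (h : Irrational ξ) : Irrational (Int.fract ξ)⁻¹ :=
  (h.sub_intCast ⌊ξ⌋).inv

theorem one_lt_inv_fract {ξ : ℝ} (h : Irrational ξ) : 1 < (Int.fract ξ)⁻¹ :=
  (one_lt_inv₀ (Int.fract_pos.mpr (h.ne_int _))).mpr (Int.fract_lt_one ξ)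

theorem one_le_pq {ξ : ℝ} (h : Irrational ξ) (h₁ : 1 < ξ) (n : ℕ) : 1 ≤ pq ξ n := by
  have hirr (n : ℕ) : Irrational (cq ξ n) := by
    induction n with
    | zero => exact h
    | succ n ih => exact irrational_inv_fract ih
  have hlt : 1 < cq ξ n := by
    cases n with
    | zero => exact h₁
    | succ n => exact one_lt_inv_fract (hirr n)
  exact Int.le_floor.mpr (by exact_mod_cast hlt.le)

/-- The recursively defined convergents are the quotients of the continuants of `pq ξ`. -/
theorem convergent_eq_continuantSeq_div {ξ : ℝ} (h : Irrational ξ) (n : ℕ) :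
    ξ.convergent n
      = (continuantSeq (pq ξ) 0 1 (n + 2) : ℚ) / continuantSeq (pq ξ) 1 0 (n + 2) := by
  induction n generalizing ξ with
  | zero => simp [continuantSeq, pq, cq]
  | succ n ih =>
    have hirr := irrational_inv_fract h
    have hshift : (fun i ↦ pq ξ (i + 1)) = pq (Int.fract ξ)⁻¹ := by
      funext i
      rw [pq, cq_succ_eq_cq_inv_fract, pq]
    have hpos := continuantSeq_pos (one_le_pq hirr (one_lt_inv_fract h)) le_rfl one_pos (n + 1)
    have hne : (continuantSeq (pq (Int.fract ξ)⁻¹) 0 1 (n + 2) : ℚ) ≠ 0 := by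
      exact_mod_cast hpos.ne'
    have hzero : pq ξ 0 = ⌊ξ⌋ := rfl
    rw [Real.convergent_succ, ih hirr, continuantSeq_succ (pq ξ) 0, continuantSeq_succ (pq ξ) 1,
      hshift, continuantSeq_eq_add _ 1 (pq ξ 0 * 1 + 0), hzero]
    simp only [mul_zero, zero_add, mul_one, add_zero, one_mul]
    push_cast
    rw [inv_div, eq_div_iff hne, add_mul, div_mul_cancel₀ _ hne, add_comm]

/-- Legendre's criterion for a fraction of coprime naturals. -/
theorem exists_div_eq_convergent {ξ : ℝ} {x y : ℕ} (hy : y ≠ 0) (hcop : Nat.Coprime x y)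
    (h : |ξ * y - x| < 1 / (2 * y)) : ∃ n, (x / y : ℚ) = ξ.convergent n := by
  have hy' : (0 : ℝ) < y := by positivity
  apply Real.exists_rat_eq_convergent
  have hden : ((x / y : ℚ)).den = y := by
    have := Rat.den_div_eq_of_coprime (a := x) (b := y) (by positivity) (by simpa using hcop)
    rw [Int.cast_natCast, Int.cast_natCast] at this
    exact Int.natCast_inj.mp this
  rw [hden]
  push_cast
  have heq : ξ - x / y = (ξ * y - x) / y := by field_simp
  rw [heq, abs_div, abs_of_pos hy', div_lt_iff₀ hy']
  refine h.trans_eq ?_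
  field_simp

/-- If `|x² - d y²| < √d`, then `x / y` is a convergent of `√d`. -/
theorem exists_div_eq_convergent_sqrt {d : ℕ} {m : ℤ} (hm : m ≠ 0)
    (hmd : |(m : ℝ)| < Real.sqrt d) {x y : ℕ} (hx : x ≠ 0) (hy : y ≠ 0) (hcop : Nat.Coprime x y)
    (hsol : (x : ℤ) ^ 2 - (d : ℤ) * (y : ℤ) ^ 2 = m) :
    ∃ n, (x / y : ℚ) = (Real.sqrt d).convergent n := by
  have hsq : Real.sqrt d ^ 2 = d := Real.sq_sqrt (Nat.cast_nonneg d)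
  have hsol' : (x : ℝ) ^ 2 - d * (y : ℝ) ^ 2 = m := by exact_mod_cast hsol
  have hx' : (0 : ℝ) < x := by positivity
  have hy' : (0 : ℝ) < y := by positivity
  have hs : 1 < Real.sqrt d := by
    have : (1 : ℝ) ≤ |(m : ℝ)| := by exact_mod_cast Int.one_le_abs hm
    linarith
  set s := Real.sqrt d
  have hs₀ : 0 < s := by linarith
  have hfac : (x - s * y) * (x + s * y) = m := by
    rw [← hsol', ← hsq]; ring
  have hsum : 0 < x + s * y := by positivity
  rcases lt_or_gt_of_ne hm with hneg | hpos
  · have hneg' : (m : ℝ) < 0 := by exact_mod_cast hneg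
    have hlt : (x : ℝ) - s * y < 0 := by
      by_contra! hc
      nlinarith [mul_nonneg hc hsum.le]
    have hbound : |s⁻¹ * x - y| < 1 / (2 * x) := by
      rw [abs_of_neg hneg'] at hmd
      have heq : s⁻¹ * x - y = (x - s * y) / s := by field_simp
      rw [heq, abs_of_neg (div_neg_of_neg_of_pos hlt hs₀), ← neg_div,
        div_lt_div_iff₀ hs₀ (by positivity)]
      nlinarith
    obtain ⟨n, hn⟩ := exists_div_eq_convergent hx hcop.symm hbound
    have hfloor : ⌊s⁻¹⌋ = 0 :=
      Int.floor_eq_zero_iff.mpr ⟨by positivity, inv_lt_one_of_one_lt₀ hs⟩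
    have hfract : Int.fract s⁻¹ = s⁻¹ := by simp [Int.fract, hfloor]
    cases n with
    | zero =>
      rw [Real.convergent_zero, hfloor] at hn
      simp [hx, hy] at hn
    | succ n =>
      refine ⟨n, ?_⟩
      rw [Real.convergent_succ, hfract, hfloor, inv_inv, Int.cast_zero, zero_add] at hn
      rw [← inv_inv (Real.convergent s n), ← hn, inv_div]
  · have hpos' : (0 : ℝ) < m := by exact_mod_cast hpos
    have hlt : 0 < (x : ℝ) - s * y := by
      by_contra! hc
      nlinarith [mul_nonneg (neg_nonneg.mpr hc) hsum.le]
    refine exists_div_eq_convergent hy hcop ?_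
    rw [abs_of_pos hpos'] at hmd
    rw [abs_sub_comm, abs_of_pos hlt, lt_div_iff₀ (by positivity)]
    nlinarith


/-- a solution in coprime positive naturals of `x² - d·y² = m`
with `|m| < √d` gives a convergent `x/y = p_n/q_n` of `√d`.
`P (n+2) = p_n`, `Q (n+2) = q_n`. -/
theorem stmt11 (d : ℕ) (hd : ¬ IsSquare d)
    (m : ℤ) (hm : m ≠ 0) (hmd : |(m : ℝ)| < Real.sqrt d)
    (P Q : ℕ → ℤ)
    (hP0 : P 0 = 0) (hP1 : P 1 = 1) (hQ0 : Q 0 = 1) (hQ1 : Q 1 = 0)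
    (hP : ∀ n, P (n + 2) = pq (Real.sqrt d) n * P (n + 1) + P n)
    (hQ : ∀ n, Q (n + 2) = pq (Real.sqrt d) n * Q (n + 1) + Q n)
    (x y : ℕ) (hx : x ≠ 0) (hy : y ≠ 0) (hcop : Nat.Coprime x y)
    (hsol : (x : ℤ) ^ 2 - (d : ℤ) * (y : ℤ) ^ 2 = m) :
    ∃ n : ℕ, (x : ℤ) = P (n + 2) ∧ (y : ℤ) = Q (n + 2) := by
  have hirr : Irrational (Real.sqrt d) := irrational_sqrt_natCast_iff.mpr hd
  have hone : 1 < Real.sqrt d := by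
    have : (1 : ℝ) ≤ |(m : ℝ)| := by exact_mod_cast Int.one_le_abs hm
    linarith
  obtain ⟨n, hn⟩ := exists_div_eq_convergent_sqrt hm hmd hx hy hcop hsol
  refine ⟨n, ?_⟩
  rw [eq_continuantSeq hP, eq_continuantSeq hQ, hP0, hP1, hQ0, hQ1]
  have hden := continuantSeq_den_pos (one_le_pq hirr hone) n
  have hcop' :=
    Int.isCoprime_iff_gcd_eq_one.mp (continuantSeq_isCoprime (pq (Real.sqrt d)) (n + 2))
  rw [convergent_eq_continuantSeq_div hirr] at hn
  exact Rat.div_int_inj (by positivity) hden (by simpa using hcop) hcop'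
    (by rwa [Int.cast_natCast, Int.cast_natCast])
end

section
/- Let a and b be integers with 2 ≤ a < b, gcd(a, b) = 1, and d := a·b not a perfect square. Let T be the minimal period of the continued fraction of √d, (u_n), (v_n) the associated sequences, p_n/q_n the convergents of √d, and set N = T/2 when T is even. Then the equation a·x² − b·y² = 1 has a solution (x, y) ∈ ℕ² if and only if T ≡ 0 (mod 4), v_N = a, and v_N divides u_N; and in that case the set of solutions is exactly { (p_{N−1+ℓT}/a, q_{N−1+ℓT}) : ℓ ∈ ℕ } (each p_{N−1+ℓT} being divisible by a). -/
theorem cq_add (x : ℝ) (m n : ℕ) : cq (cq x m) n = cq x (m + n) := by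
  induction n with
  | zero => rfl
  | succ n ih => rw [← Nat.add_assoc, cq, cq, ih]

theorem convergent_eq_of_pq_eq {x y : ℝ} (h : ∀ n, pq x n = pq y n) (n : ℕ) :
    x.convergent n = y.convergent n := by
  induction n generalizing x y with
  | zero =>
    have h0 : ⌊x⌋ = ⌊y⌋ := h 0
    simp [h0]
  | succ n ih =>
    have h0 : ⌊x⌋ = ⌊y⌋ := h 0
    rw [Real.convergent_succ, Real.convergent_succ, h0,
      ih (x := (Int.fract x)⁻¹) (y := (Int.fract y)⁻¹)]
    intro k
    have hk : ∀ z : ℝ, pq (Int.fract z)⁻¹ k = pq z (1 + k) := fun z => by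
      rw [pq, pq, ← cq_add]; rfl
    rw [hk, hk, h]

/-- A real number is determined by its partial quotients. -/
theorem eq_of_pq_eq {x y : ℝ} (h : ∀ n, pq x n = pq y n) : x = y := by
  refine tendsto_nhds_unique (GenContFract.of_convergence x) ?_
  have : (GenContFract.of x).convs = (GenContFract.of y).convs := by
    funext n
    rw [Real.convs_eq_convergent, Real.convs_eq_convergent, convergent_eq_of_pq_eq h]
  rw [this]
  exact GenContFract.of_convergence y

theorem floor_le_convergent (x : ℝ) (n : ℕ) : (⌊x⌋ : ℚ) ≤ x.convergent n := by
  induction n generalizing x with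
  | zero => simp
  | succ n ih =>
    rw [Real.convergent_succ]
    have h : (0 : ℤ) ≤ ⌊(Int.fract x)⁻¹⌋ := Int.floor_nonneg.2 (by simp)
    have h' : (0 : ℚ) ≤ (Int.fract x)⁻¹.convergent n := le_trans (by exact_mod_cast h) (ih _)
    have := inv_nonneg.2 h'
    linarith

/-- The continuants `P`, `Q` of a number with positive partial quotients represent its
convergents as Möbius images of the convergents of its complete quotients. -/
theorem convergent_cq_mobius {x : ℝ} {P Q : ℕ → ℤ} (hpos : ∀ n, 1 ≤ pq x (n + 1))
    (hP : ∀ n, P (n + 2) = pq x n * P (n + 1) + P n)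
    (hQ : ∀ n, Q (n + 2) = pq x n * Q (n + 1) + Q n) (k n : ℕ) :
    ((P (n + 1) : ℚ) * (cq x n).convergent k + P n) * Q (n + k + 2) =
      P (n + k + 2) * (Q (n + 1) * (cq x n).convergent k + Q n) := by
  induction k generalizing n with
  | zero =>
    have h : (cq x n).convergent 0 = (pq x n : ℚ) := by simp [pq]
    simp only [h, Nat.add_zero, hP, hQ]
    push_cast
    ring
  | succ k ih =>
    have h1 : (0 : ℚ) < (cq x (n + 1)).convergent k := by
      refine lt_of_lt_of_le ?_ (floor_le_convergent _ k)
      have h := hpos n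
      rw [pq] at h
      exact_mod_cast h
    have h2 : (cq x n).convergent (k + 1) = pq x n + ((cq x (n + 1)).convergent k)⁻¹ :=
      Real.convergent_succ _ _
    have h3 := ih (n + 1)
    rw [show n + 1 + k + 2 = n + (k + 1) + 2 by ring, hP n, hQ n] at h3
    push_cast at h3
    rw [h2]
    generalize (cq x (n + 1)).convergent k = c at *
    field_simp
    linear_combination h3

theorem continuant_det {A P Q : ℕ → ℤ}
    (hP0 : P 0 = 0) (hP1 : P 1 = 1) (hQ0 : Q 0 = 1) (hQ1 : Q 1 = 0)
    (hP : ∀ n, P (n + 2) = A n * P (n + 1) + P n)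
    (hQ : ∀ n, Q (n + 2) = A n * Q (n + 1) + Q n) (n : ℕ) :
    P (n + 1) * Q n - P n * Q (n + 1) = (-1) ^ n := by
  induction n with
  | zero => simp [hP0, hP1, hQ0, hQ1]
  | succ n ih =>
    rw [hP, hQ, pow_succ]
    linear_combination -ih

theorem continuant_pos {A Q : ℕ → ℤ} (hQ0 : Q 0 = 1) (hQ1 : Q 1 = 0)
    (hA : ∀ n, 0 < A n) (hQ : ∀ n, Q (n + 2) = A n * Q (n + 1) + Q n) (n : ℕ) :
    0 < Q (n + 2) := by
  have h : ∀ n, 0 ≤ Q (n + 1) ∧ 0 < Q (n + 2) := by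
    intro n
    induction n with
    | zero => simp [hQ, hQ0, hQ1]
    | succ n ih =>
      refine ⟨ih.2.le, ?_⟩
      rw [hQ (n + 1)]
      have := mul_pos (hA (n + 1)) ih.2
      linarith [ih.1]
  exact (h n).2

theorem eq_and_eq_of_mul_eq_mul {p q r s : ℤ} (hpq : IsCoprime p q) (hrs : IsCoprime r s)
    (hq : 0 < q) (hs : 0 < s) (h : p * s = r * q) : p = r ∧ q = s := by
  have h1 : q ∣ s := hpq.symm.dvd_of_dvd_mul_left ⟨r, by linear_combination h⟩
  have h2 : s ∣ q := hrs.symm.dvd_of_dvd_mul_left ⟨p, by linear_combination -h⟩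
  have h3 := Int.dvd_antisymm hq.le hs.le h1 h2
  subst h3
  exact ⟨mul_right_cancel₀ hq.ne' h, rfl⟩

/-- A reduced fraction `p / q` with `0 < p ^ 2 - d q ^ 2 < √d` is a convergent of `√d`. -/
theorem exists_eq_convergent_of_norm_lt {d : ℕ} {p q : ℤ} (hp : 0 < p) (hq : 0 < q)
    (hpq : IsCoprime p q) (h0 : 0 < p ^ 2 - d * q ^ 2)
    (h1 : ((p ^ 2 - d * q ^ 2 : ℤ) : ℝ) < √d) :
    ∃ k, (p / q : ℚ) = (√d : ℝ).convergent k := by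
  have hden : (((p : ℚ) / q).den : ℤ) = q :=
    Rat.den_div_eq_of_coprime hq (Int.isCoprime_iff_gcd_eq_one.1 hpq)
  have hden' : (((p : ℚ) / q).den : ℝ) = q := by exact_mod_cast hden
  apply Real.exists_rat_eq_convergent
  rw [hden']
  push_cast at h1 ⊢
  have hp' : (0 : ℝ) < p := by exact_mod_cast hp
  have hq' : (0 : ℝ) < q := by exact_mod_cast hq
  have h0' : (0 : ℝ) < (p : ℝ) ^ 2 - d * (q : ℝ) ^ 2 := by exact_mod_cast h0
  have hs := Real.sq_sqrt (Nat.cast_nonneg d : (0 : ℝ) ≤ d)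
  have hs0 := Real.sqrt_nonneg (d : ℝ)
  generalize √(d : ℝ) = s at *
  rw [← hs] at h0' h1
  have hlt : s * q < p := by
    by_contra! hle
    nlinarith [mul_self_le_mul_self hp'.le hle]
  have hfac : ((p : ℝ) - s * q) * (p + s * q) < s := by linear_combination h1
  have habs : |s - (p : ℝ) / q| = (p - s * q) / q := by
    rw [abs_of_neg]
    · field_simp
      ring
    · rw [sub_neg, lt_div_iff₀ hq']
      exact hlt
  rw [habs, div_lt_div_iff₀ hq' (by positivity)]
  have hs1 : 0 < s := by
    rcases hs0.lt_or_eq with h | h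
    · exact h
    · subst h
      nlinarith [mul_pos (sub_pos.2 hlt) hp']
  have h2 : (p - s * q) * (2 * (s * q)) < s := by
    nlinarith [mul_pos (sub_pos.2 hlt) (sub_pos.2 hlt)]
  have h3 : (p - s * q) * (2 * q) < 1 := by
    by_contra! hle
    nlinarith [mul_le_mul_of_nonneg_left hle hs1.le]
  nlinarith [mul_lt_mul_of_pos_right h3 hq']

/-- The quadratic irrationals `(u n + √d) / v n` satisfy `u n < √d < u n + v n` and their
integer parts `A n` drive the recursion for `(u n, v n)`. -/
structure SurdExpansion (d : ℕ) (A u v : ℕ → ℤ) : Prop where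
  v_pos : ∀ n, 0 < v n
  lt_sqrt : ∀ n, (u n : ℝ) < √d
  sqrt_lt : ∀ n, √d < u n + v n
  floor_eq : ∀ n, A n = ⌊(u n + √d) / v n⌋
  u_succ : ∀ n, u (n + 1) = A n * v n - u n
  v_succ : ∀ n, v n * v (n + 1) = (d : ℤ) - u (n + 1) ^ 2

namespace SurdExpansion

variable {d : ℕ} {A u v : ℕ → ℤ}

theorem state_succ (h : SurdExpansion d A u v) {m n : ℕ} (hu : u m = u n) (hv : v m = v n) :
    u (m + 1) = u (n + 1) ∧ v (m + 1) = v (n + 1) := by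
  have h1 : u (m + 1) = u (n + 1) := by
    rw [h.u_succ, h.u_succ, h.floor_eq, h.floor_eq, hu, hv]
  refine ⟨h1, mul_left_cancel₀ (h.v_pos n).ne' ?_⟩
  rw [h.v_succ n, ← h1, ← h.v_succ m, hv]

theorem floor_eq_reflect (h : SurdExpansion d A u v) (n : ℕ) :
    A n = ⌊(u (n + 1) + √d) / v n⌋ := by
  have hv : (0 : ℝ) < v n := by exact_mod_cast h.v_pos n
  symm
  rw [Int.floor_eq_iff, le_div_iff₀ hv, div_lt_iff₀ hv, h.u_succ]
  push_cast
  constructor <;> linarith [h.lt_sqrt n, h.sqrt_lt n]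

theorem state_pred (h : SurdExpansion d A u v) {m n : ℕ} (hu : u (m + 1) = u (n + 1))
    (hv : v (m + 1) = v (n + 1)) : u m = u n ∧ v m = v n := by
  have h1 : v m = v n := by
    refine mul_right_cancel₀ (h.v_pos (n + 1)).ne' ?_
    rw [h.v_succ n, ← hu, ← h.v_succ m, hv]
  refine ⟨?_, h1⟩
  have hA : A m = A n := by rw [h.floor_eq_reflect m, h.floor_eq_reflect n, hu, h1]
  rw [h.u_succ, h.u_succ, hA, h1] at hu
  linarith

theorem state_add (h : SurdExpansion d A u v) {m n : ℕ} (hu : u m = u n) (hv : v m = v n)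
    (k : ℕ) : u (m + k) = u (n + k) ∧ v (m + k) = v (n + k) := by
  induction k with
  | zero => exact ⟨hu, hv⟩
  | succ k ih => exact h.state_succ ih.1 ih.2

theorem state_add_mul (h : SurdExpansion d A u v) {T : ℕ} (hu : u T = u 0) (hv : v T = v 0)
    (n l : ℕ) : u (n + l * T) = u n ∧ v (n + l * T) = v n := by
  induction l with
  | zero => simp
  | succ l ih =>
    have h1 := h.state_add hu hv (n + l * T)
    rw [show n + (l + 1) * T = T + (n + l * T) by ring]
    rw [Nat.zero_add] at h1
    exact ⟨h1.1.trans ih.1, h1.2.trans ih.2⟩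

theorem reflect (h : SurdExpansion d A u v) (i j : ℕ) (hu : u (i + 1) = u j) (hv : v i = v j) :
    u (i + j) = u 1 ∧ v (i + j) = v 0 := by
  induction i generalizing j with
  | zero => simp_all
  | succ i ih =>
    have hA : A j = A (i + 1) := by rw [h.floor_eq j, h.floor_eq_reflect (i + 1), hu, hv]
    have h1 : u (i + 1) = u (j + 1) := by
      have := h.u_succ (i + 1)
      rw [h.u_succ j, hA, ← hv, ← hu]
      linarith
    have h2 : v i = v (j + 1) := by
      refine mul_left_cancel₀ (h.v_pos j).ne' ?_
      rw [h.v_succ j, ← h1, ← h.v_succ i, ← hv]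
      ring
    have := ih (j + 1) h1 h2
    rwa [show i + (j + 1) = i + 1 + j by ring] at this

/-- If `v n ∣ u n`, then `(u, v)` is symmetric about `n`. -/
theorem state_two_mul (h : SurdExpansion d A u v) {n : ℕ} (hn : v n ∣ u n) :
    u (2 * n) = u 1 ∧ v (2 * n) = v 0 := by
  have h1 : v n ∣ u (n + 1) - u n := by
    rw [h.u_succ]
    exact dvd_sub (dvd_sub (dvd_mul_left _ _) hn) hn
  have h2 : (u n : ℝ) < √d ∧ √d < u n + v n := ⟨h.lt_sqrt n, h.sqrt_lt n⟩
  have h3 : (u (n + 1) : ℝ) < √d ∧ √d < u (n + 1) + v n := by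
    have hv : (0 : ℝ) < v n := by exact_mod_cast h.v_pos n
    have hf := h.floor_eq n
    rw [eq_comm, Int.floor_eq_iff, le_div_iff₀ hv, div_lt_iff₀ hv] at hf
    refine ⟨lt_of_le_of_ne ?_ ?_, ?_⟩
    · rw [h.u_succ]; push_cast; linarith
    · intro heq
      have hpos : (0 : ℤ) < (d : ℤ) - u (n + 1) ^ 2 := by
        rw [← h.v_succ]; exact mul_pos (h.v_pos _) (h.v_pos _)
      have hpos' : (0 : ℝ) < (d : ℝ) - (u (n + 1) : ℝ) ^ 2 := by exact_mod_cast hpos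
      rw [heq, Real.sq_sqrt (Nat.cast_nonneg d)] at hpos'
      simp at hpos'
    · rw [h.u_succ]; push_cast; linarith
  have h4 : u (n + 1) < u n + v n := by
    have : (u (n + 1) : ℝ) < u n + v n := by linarith
    exact_mod_cast this
  have h5 : u n < u (n + 1) + v n := by
    have : (u n : ℝ) < u (n + 1) + v n := by linarith
    exact_mod_cast this
  have h6 : u (n + 1) - u n = 0 :=
    Int.eq_zero_of_abs_lt_dvd h1 (abs_lt.2 ⟨by linarith, by linarith⟩)
  rw [two_mul]
  exact h.reflect n n (by linarith) rfl

theorem eq_of_div_eq (h : SurdExpansion d A u v) (hd : Irrational √(d : ℝ)) {m n : ℕ}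
    (hmn : ((u m : ℝ) + √d) / v m = (u n + √d) / v n) : u m = u n ∧ v m = v n := by
  have hm : (0 : ℝ) < v m := by exact_mod_cast h.v_pos m
  have hn : (0 : ℝ) < v n := by exact_mod_cast h.v_pos n
  rw [div_eq_div_iff hm.ne' hn.ne'] at hmn
  have hv : v m = v n := by
    by_contra hne
    have hne' : (v n : ℝ) - v m ≠ 0 := sub_ne_zero.2 (by exact_mod_cast Ne.symm hne)
    refine hd ⟨(u n * v m - u m * v n : ℚ) / (v n - v m), ?_⟩
    push_cast
    rw [div_eq_iff hne']
    linear_combination -hmn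
  refine ⟨?_, hv⟩
  rw [hv] at hmn
  have := mul_right_cancel₀ hn.ne' hmn
  exact_mod_cast add_right_cancel this

/-- The recursion for the expansion of `√d`, started at `a₀ + √d`. -/
theorem of_sqrt (hd : Irrational √(d : ℝ)) (hA0 : A 0 = 2 * pq √d 0)
    (hA : ∀ n, A (n + 1) = pq √d (n + 1)) (hu0 : u 0 = pq √d 0) (hu0_pos : 0 < u 0)
    (hv0 : v 0 = 1) (hv_pos : ∀ n, 0 < v n) (hu : ∀ n, u (n + 1) = A n * v n - u n)
    (hv : ∀ n, v n * v (n + 1) = (d : ℤ) - u (n + 1) ^ 2) :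
    SurdExpansion d A u v ∧ (∀ n, cq √d (n + 1) = (u (n + 1) + √d) / v (n + 1)) ∧
      ∀ n, 0 < pq √d n := by
  have hfl : pq √d 0 = ⌊√(d : ℝ)⌋ := rfl
  have hvr : ∀ n, (0 : ℝ) < v n := fun n => by exact_mod_cast hv_pos n
  have hs := Real.sq_sqrt (Nat.cast_nonneg d : (0 : ℝ) ≤ d)
  have key : ∀ n, ((u n : ℝ) < √d ∧ √d < u n + v n ∧ (v n : ℝ) < u n + √d ∧
      A n = ⌊((u n : ℝ) + √d) / v n⌋ ∧ Int.fract (cq √d n) = Int.fract (((u n : ℝ) + √d) / v n)) ∧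
      cq √d (n + 1) = (u (n + 1) + √d) / v (n + 1) := by
    have step : ∀ n, ((u n : ℝ) < √d ∧ √d < u n + v n ∧ (v n : ℝ) < u n + √d ∧
        A n = ⌊((u n : ℝ) + √d) / v n⌋ ∧
        Int.fract (cq √d n) = Int.fract (((u n : ℝ) + √d) / v n)) →
        (√d - u (n + 1)) / v n = Int.fract (((u n : ℝ) + √d) / v n) ∧
        cq √d (n + 1) = (u (n + 1) + √d) / v (n + 1) := by
      rintro n ⟨-, -, -, h4, h5⟩
      have h6 : (√d - u (n + 1)) / v n = Int.fract (((u n : ℝ) + √d) / v n) := by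
        rw [Int.fract, ← h4, hu]
        have := (hvr n).ne'
        push_cast
        field_simp
        ring
      refine ⟨h6, ?_⟩
      rw [cq, h5, ← h6, inv_div]
      have hne : √(d : ℝ) - u (n + 1) ≠ 0 := sub_ne_zero.2 (hd.ne_int _)
      rw [div_eq_div_iff hne (hvr _).ne']
      have : (v n : ℝ) * v (n + 1) = d - (u (n + 1) : ℝ) ^ 2 := by exact_mod_cast hv n
      linear_combination this - hs
    intro n
    induction n with
    | zero =>
      have h0 : (u 0 : ℝ) < √d :=
        lt_of_le_of_ne (by rw [hu0, hfl]; exact Int.floor_le _) (hd.ne_int _).symm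
      have h1 : √d < (u 0 : ℝ) + v 0 := by
        rw [hu0, hfl, hv0]; push_cast; exact Int.lt_floor_add_one _
      have h2 : (1 : ℝ) ≤ u 0 := by exact_mod_cast hu0_pos
      have h3 : (u 0 : ℝ) < √d ∧ √d < u 0 + v 0 ∧ (v 0 : ℝ) < u 0 + √d ∧
          A 0 = ⌊((u 0 : ℝ) + √d) / v 0⌋ ∧
          Int.fract (cq √d 0) = Int.fract (((u 0 : ℝ) + √d) / v 0) := by
        refine ⟨h0, h1, ?_, ?_, ?_⟩
        · rw [hv0]; push_cast; linarith
        · rw [hv0, Int.cast_one, div_one, Int.floor_intCast_add, hA0, hu0, hfl]; ring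
        · rw [hv0, Int.cast_one, div_one, Int.fract_intCast_add]; rfl
      exact ⟨h3, (step 0 h3).2⟩
    | succ n ih =>
      obtain ⟨h6, h7⟩ := step n ih.1
      obtain ⟨⟨i1, i2, i3, i4, i5⟩, -⟩ := ih
      have hf0 := Int.fract_nonneg (((u n : ℝ) + √d) / v n)
      have hf1 := Int.fract_lt_one (((u n : ℝ) + √d) / v n)
      rw [← h6] at hf0 hf1
      have hlt : (u (n + 1) : ℝ) < √d := by
        refine lt_of_le_of_ne ?_ (hd.ne_int _).symm
        have := (le_div_iff₀ (hvr n)).1 hf0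
        linarith
      rw [div_lt_one (hvr n)] at hf1
      have hA1 : 1 ≤ A n := by
        rw [i4, Int.le_floor, Int.cast_one, one_le_div (hvr n)]
        exact i3.le
      have hA1' : (1 : ℝ) ≤ A n := by exact_mod_cast hA1
      have hur : (u (n + 1) : ℝ) = A n * v n - u n := by exact_mod_cast hu n
      have hvv : (√d - u (n + 1)) * (√d + u (n + 1)) = (v n : ℝ) * v (n + 1) := by
        have : (v n : ℝ) * v (n + 1) = d - (u (n + 1) : ℝ) ^ 2 := by exact_mod_cast hv n
        linear_combination hs - this
      have hbig : (v n : ℝ) < √d + u (n + 1) := by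
        nlinarith [mul_le_mul_of_nonneg_right hA1' (hvr n).le]
      have hsub : √d - u (n + 1) < (v (n + 1) : ℝ) := by
        by_contra! hle
        nlinarith [mul_le_mul_of_nonneg_right hle (hvr n).le,
          mul_lt_mul_of_pos_left hbig (sub_pos.2 hlt)]
      have hadd : (v (n + 1) : ℝ) < u (n + 1) + √d := by
        by_contra! hle
        nlinarith [mul_le_mul_of_nonneg_left hle (hvr n).le,
          mul_lt_mul_of_pos_right hf1 ((hvr n).trans hbig)]
      have h8 : (u (n + 1) : ℝ) < √d ∧ √d < u (n + 1) + v (n + 1) ∧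
          (v (n + 1) : ℝ) < u (n + 1) + √d ∧
          A (n + 1) = ⌊((u (n + 1) : ℝ) + √d) / v (n + 1)⌋ ∧
          Int.fract (cq √d (n + 1)) = Int.fract (((u (n + 1) : ℝ) + √d) / v (n + 1)) :=
        ⟨hlt, by linarith, hadd, by rw [hA, pq, h7], by rw [h7]⟩
      exact ⟨h8, (step _ h8).2⟩
  refine ⟨⟨hv_pos, fun n => (key n).1.1, fun n => (key n).1.2.1, fun n => (key n).1.2.2.2.1,
    hu, hv⟩, fun n => (key n).2, ?_⟩
  rintro (_ | n)
  · exact hu0 ▸ hu0_pos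
  · rw [← hA, (key _).1.2.2.2.1, Int.floor_pos, one_le_div (hvr _)]
    exact (key _).1.2.2.1.le

/-- The complete quotients give the continuants as solutions of `p ^ 2 - d q ^ 2 = ± v n`. -/
theorem continuant_relations (h : SurdExpansion d A u v) {a P Q : ℕ → ℤ}
    (hA0 : A 0 = 2 * a 0) (hA : ∀ n, A (n + 1) = a (n + 1)) (hu0 : u 0 = a 0) (hv0 : v 0 = 1)
    (hP0 : P 0 = 0) (hP1 : P 1 = 1) (hQ0 : Q 0 = 1) (hQ1 : Q 1 = 0)
    (hP : ∀ n, P (n + 2) = a n * P (n + 1) + P n)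
    (hQ : ∀ n, Q (n + 2) = a n * Q (n + 1) + Q n) (n : ℕ) :
    P (n + 2) = u (n + 1) * Q (n + 2) + v (n + 1) * Q (n + 1) ∧
      d * Q (n + 2) = u (n + 1) * P (n + 2) + v (n + 1) * P (n + 1) := by
  induction n with
  | zero =>
    have h1 := h.u_succ 0
    have h2 := h.v_succ 0
    simp only [Nat.zero_add, hP, hQ, hP0, hP1, hQ0, hQ1, hA0, hu0, hv0] at *
    rw [h1] at h2 ⊢
    constructor <;> linarith
  | succ n ih =>
    have h1 := h.u_succ (n + 1)
    have h2 := h.v_succ (n + 1)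
    have hv := (h.v_pos (n + 1)).ne'
    obtain ⟨i1, i2⟩ := ih
    rw [hA] at h1
    rw [hP (n + 1), hQ (n + 1)]
    simp only [Nat.add_assoc, Nat.reduceAdd] at *
    rw [h1] at h2 ⊢
    constructor
    · refine mul_left_cancel₀ hv ?_
      linear_combination (a (n + 1) * v (n + 1) - u (n + 1)) * i1 - i2 - Q (n + 2) * h2
    · refine mul_left_cancel₀ hv ?_
      linear_combination -d * i1 + (a (n + 1) * v (n + 1) - u (n + 1)) * i2 - P (n + 2) * h2

theorem state_period (h : SurdExpansion d A u v) (hd : Irrational √(d : ℝ))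
    (hcq : ∀ n, cq √d (n + 1) = (u (n + 1) + √d) / v (n + 1)) {T : ℕ}
    (hper : ∀ n, 1 ≤ n → pq √d (n + T) = pq √d n) : u T = u 0 ∧ v T = v 0 := by
  have h1 : cq √d (T + 1) = cq √d (0 + 1) := by
    refine eq_of_pq_eq fun k => ?_
    have h2 := hper (1 + k) (by omega)
    rw [pq, pq, cq_add, cq_add, ← pq, ← pq, Nat.zero_add, ← h2]
    congr 1
    ring
  rw [hcq, hcq] at h1
  have h2 := h.eq_of_div_eq hd h1
  exact h.state_pred h2.1 h2.2

theorem dvd_of_state_eq (h : SurdExpansion d A u v)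
    (hcq : ∀ n, cq √d (n + 1) = (u (n + 1) + √d) / v (n + 1)) {T : ℕ} (hT : 1 ≤ T)
    (hu : u T = u 0) (hv : v T = v 0)
    (hmin : ∀ T', 1 ≤ T' → (∀ n, 1 ≤ n → pq √d (n + T') = pq √d n) → T ≤ T')
    {k : ℕ} (huk : u k = u 0) (hvk : v k = v 0) : T ∣ k := by
  have h1 := h.state_add_mul hu hv (k % T) (k / T)
  rw [Nat.mod_add_div'] at h1
  rw [Nat.dvd_iff_mod_eq_zero]
  by_contra hne
  refine (Nat.mod_lt k hT).not_ge (hmin (k % T) (Nat.one_le_iff_ne_zero.2 hne) ?_)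
  rintro (_ | n) hn
  · omega
  · have h2 := h.state_add (m := k % T) (n := 0) (h1.1.symm.trans huk) (h1.2.symm.trans hvk) (n + 1)
    rw [Nat.zero_add, Nat.add_comm] at h2
    rw [Nat.add_right_comm] at h2 ⊢
    rw [pq, pq, hcq, hcq, h2.1, h2.2]

/-- The indices `n` with `v n ≠ v 0` and `v n ∣ u n` are the odd multiples of half the period. -/
theorem eq_half_period_add (h : SurdExpansion d A u v)
    (hcq : ∀ n, cq √d (n + 1) = (u (n + 1) + √d) / v (n + 1)) (hu1 : u 1 = u 0)
    {T : ℕ} (hT : 1 ≤ T) (hu : u T = u 0) (hv : v T = v 0)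
    (hmin : ∀ T', 1 ≤ T' → (∀ n, 1 ≤ n → pq √d (n + T') = pq √d n) → T ≤ T')
    {n : ℕ} (hvn : v n ≠ v 0) (hdvd : v n ∣ u n) : T % 2 = 0 ∧ ∃ l, n = T / 2 + l * T := by
  have h1 := h.state_two_mul hdvd
  obtain ⟨m, hm⟩ := h.dvd_of_state_eq hcq hT hu hv hmin (h1.1.trans hu1) h1.2
  obtain ⟨l, hl | hl⟩ := Nat.even_or_odd' m
  · refine absurd ?_ hvn
    have : n = 0 + l * T := by subst hl; nlinarith
    rw [this]
    exact (h.state_add_mul hu hv 0 l).2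
  · subst hl
    have h2 : T = 2 * (n - l * T) := by
      have : 2 * n = T + 2 * (l * T) := by rw [hm]; ring
      omega
    generalize hlT : l * T = z at h2
    refine ⟨by omega, l, by omega⟩

end SurdExpansion

/-- Theorem 19, case `a < b`: solvability and solutions of
`a·x² - b·y² = 1`.  With `N = T/2`, solutions are exactly the pairs
`(p_{N-1+ℓT}/a, q_{N-1+ℓT})`, where `P (n+2) = p_n`, `Q (n+2) = q_n`
(so `p_{N-1+ℓT} = P (N + ℓT + 1)`). -/
theorem stmt16 (a b : ℕ) (ha2 : 2 ≤ a) (hab : a < b) (hcop : Nat.Coprime a b)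
    (d : ℕ) (hdab : d = a * b) (hd : ¬ IsSquare d)
    (aq aq' : ℕ → ℤ) (haq : ∀ n, aq n = pq (Real.sqrt d) n)
    (haq'0 : aq' 0 = 2 * aq 0) (haq' : ∀ n, 1 ≤ n → aq' n = aq n)
    (u v : ℕ → ℤ) (hu0 : u 0 = aq 0) (hv0 : v 0 = 1)
    (hupos : ∀ n, 0 < u n) (hvpos : ∀ n, 0 < v n)
    (hu : ∀ n, u (n + 1) = aq' n * v n - u n)
    (hv : ∀ n, v n * v (n + 1) = (d : ℤ) - (u (n + 1)) ^ 2)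
    (P Q : ℕ → ℤ)
    (hP0 : P 0 = 0) (hP1 : P 1 = 1) (hQ0 : Q 0 = 1) (hQ1 : Q 1 = 0)
    (hP : ∀ n, P (n + 2) = aq n * P (n + 1) + P n)
    (hQ : ∀ n, Q (n + 2) = aq n * Q (n + 1) + Q n)
    (T : ℕ) (hT : 1 ≤ T)
    (hper : ∀ n, 1 ≤ n → pq (Real.sqrt d) (n + T) = pq (Real.sqrt d) n)
    (hmin : ∀ T', 1 ≤ T' →
      (∀ n, 1 ≤ n → pq (Real.sqrt d) (n + T') = pq (Real.sqrt d) n) → T ≤ T') :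
    ((∃ x y : ℕ, (a : ℤ) * (x : ℤ) ^ 2 - (b : ℤ) * (y : ℤ) ^ 2 = 1) ↔
      (T % 4 = 0 ∧ v (T / 2) = (a : ℤ) ∧ v (T / 2) ∣ u (T / 2))) ∧
    ((T % 4 = 0 ∧ v (T / 2) = (a : ℤ) ∧ v (T / 2) ∣ u (T / 2)) →
      ∀ x y : ℕ, ((a : ℤ) * (x : ℤ) ^ 2 - (b : ℤ) * (y : ℤ) ^ 2 = 1) ↔
        (∃ l : ℕ, (a : ℤ) ∣ P (T / 2 + l * T + 1) ∧
          (a : ℤ) * (x : ℤ) = P (T / 2 + l * T + 1) ∧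
          (y : ℤ) = Q (T / 2 + l * T + 1))) := by
  have hirr : Irrational √(d : ℝ) := irrational_sqrt_natCast_iff.2 hd
  obtain ⟨hE, hcq, hpos⟩ := SurdExpansion.of_sqrt hirr (A := aq') (u := u) (v := v)
    (by rw [haq'0, haq]) (fun n => by rw [haq' _ (by omega), haq]) (by rw [hu0, haq]) (hupos 0)
    hv0 hvpos hu hv
  have hstate := hE.state_period hirr hcq hper
  have hu1 : u 1 = u 0 := by rw [hu 0, haq'0, hv0, hu0]; ring
  have hrel := hE.continuant_relations haq'0 (fun n => haq' _ (by omega)) hu0 hv0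
    hP0 hP1 hQ0 hQ1 hP hQ
  have hdet := continuant_det hP0 hP1 hQ0 hQ1 hP hQ
  have hQpos := continuant_pos hQ0 hQ1 (fun n => by rw [haq]; exact hpos n) hQ
  have hPpos : ∀ n, 0 < P (n + 2) := by
    intro n
    rw [(hrel n).1]
    have h1 := mul_pos (hupos (n + 1)) (hQpos n)
    have h2 : 0 ≤ Q (n + 1) := by
      rcases n with _ | n
      · exact hQ1.ge
      · exact (hQpos n).le
    have h3 := mul_nonneg (hvpos (n + 1)).le h2
    linarith
  have hnorm : ∀ n, P (n + 2) ^ 2 - d * Q (n + 2) ^ 2 = (-1) ^ (n + 1) * v (n + 1) := by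
    intro n
    obtain ⟨h1, h2⟩ := hrel n
    linear_combination P (n + 2) * h1 - Q (n + 2) * h2 + v (n + 1) * hdet (n + 1)
  have hdab' : (d : ℤ) = a * b := by exact_mod_cast hdab
  have ha0 : (0 : ℤ) < a := by omega
  have hsol : ∀ x y : ℕ, (a : ℤ) * (x : ℤ) ^ 2 - (b : ℤ) * (y : ℤ) ^ 2 = 1 →
      T % 4 = 0 ∧ ∃ l : ℕ, v (T / 2 + l * T) = a ∧ v (T / 2 + l * T) ∣ u (T / 2 + l * T) ∧
        (a : ℤ) * x = P (T / 2 + l * T + 1) ∧ (y : ℤ) = Q (T / 2 + l * T + 1) := by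
    intro x y hxy
    have hx : 0 < x := by
      by_contra! h
      obtain rfl : x = 0 := by omega
      have : 0 ≤ (b : ℤ) * (y : ℤ) ^ 2 := by positivity
      norm_num at hxy
      linarith
    have hy : 0 < y := by
      by_contra! h
      obtain rfl : y = 0 := by omega
      have h1 : (a : ℤ) ∣ 1 := ⟨(x : ℤ) ^ 2, by linear_combination -hxy⟩
      have := Int.le_of_dvd one_pos h1
      omega
    have hcop' : IsCoprime ((a : ℤ) * x) (y : ℤ) :=
      ⟨x, -(b * y), by linear_combination hxy⟩
    have hval : ((a : ℤ) * x) ^ 2 - d * (y : ℤ) ^ 2 = a := by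
      rw [hdab']
      linear_combination (a : ℤ) * hxy
    have hx' : 0 < (a : ℤ) * x := by positivity
    have hy' : 0 < (y : ℤ) := by exact_mod_cast hy
    obtain ⟨k, hk⟩ := exists_eq_convergent_of_norm_lt hx' hy' hcop' (by rw [hval]; exact ha0) (by
      rw [hval]
      push_cast
      apply Real.lt_sqrt_of_sq_lt
      have : a ^ 2 < d := by rw [hdab]; nlinarith
      exact_mod_cast this)
    have hmob := convergent_cq_mobius (x := √d) (P := P) (Q := Q)
      (fun n => hpos _) (fun n => by rw [hP, haq]) (fun n => by rw [hQ, haq]) k 0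
    have hyq : (y : ℚ) ≠ 0 := by positivity
    simp only [cq, ← hk, Nat.zero_add, hP0, hP1, hQ0, hQ1] at hmob
    push_cast at hmob
    field_simp at hmob
    have hmob' : ((a : ℤ) * x) * Q (k + 2) = P (k + 2) * y := by
      have : ((a : ℚ) * x) * Q (k + 2) = P (k + 2) * y := by linear_combination hmob
      exact_mod_cast this
    have hPQ : IsCoprime (P (k + 2)) (Q (k + 2)) := by
      have h1 := hdet (k + 1)
      have h2 : ((-1 : ℤ) ^ (k + 1)) * (-1) ^ (k + 1) = 1 := by rw [← mul_pow]; simp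
      exact ⟨(-1) ^ (k + 1) * Q (k + 1), -((-1) ^ (k + 1) * P (k + 1)), by
        linear_combination (-1) ^ (k + 1) * h1 + h2⟩
    obtain ⟨e1, e2⟩ := eq_and_eq_of_mul_eq_mul hcop' hPQ hy' (hQpos k) hmob'
    have hn := hnorm k
    rw [← e1, ← e2, hval] at hn
    have heven : Even (k + 1) := by
      by_contra hodd
      rw [(Nat.not_even_iff_odd.1 hodd).neg_one_pow] at hn
      linarith [hvpos (k + 1)]
    rw [heven.neg_one_pow, one_mul] at hn
    have hdvd : v (k + 1) ∣ u (k + 1) := by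
      rw [← hn]
      have h1 : (a : ℤ) ∣ y * u (k + 1) :=
        ⟨x - Q (k + 1), by rw [e2]; linear_combination -e1 - (hrel k).1 + Q (k + 1) * hn⟩
      exact (IsCoprime.of_mul_left_left hcop').dvd_of_dvd_mul_left h1
    have hv_ne : v (k + 1) ≠ v 0 := by rw [← hn, hv0]; omega
    obtain ⟨hT2, l, hl⟩ := hE.eq_half_period_add hcq hu1 hT hstate.1 hstate.2 hmin hv_ne hdvd
    have hT4 : T % 4 = 0 := by
      have h1 : Even (l * T) := (Nat.even_iff.2 hT2).mul_left l
      rw [hl, Nat.even_add] at heven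
      have := Nat.even_iff.1 (heven.2 h1)
      omega
    refine ⟨hT4, l, ?_⟩
    rw [← hl]
    exact ⟨hn.symm, hdvd, e1, e2⟩
  have hconv : T % 4 = 0 → v (T / 2) = (a : ℤ) → v (T / 2) ∣ u (T / 2) → ∀ l : ℕ,
      (a : ℤ) ∣ P (T / 2 + l * T + 1) ∧ 0 < P (T / 2 + l * T + 1) ∧
        0 < Q (T / 2 + l * T + 1) ∧
        P (T / 2 + l * T + 1) ^ 2 - d * Q (T / 2 + l * T + 1) ^ 2 = a := by
    intro hT4 hva hdvd l
    obtain ⟨s1, s2⟩ := hE.state_add_mul hstate.1 hstate.2 (T / 2) l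
    have heven : Even (T / 2 + l * T) :=
      (Nat.even_iff.2 (by omega)).add ((Nat.even_iff.2 (by omega)).mul_left l)
    obtain ⟨k, hk⟩ : ∃ k, T / 2 + l * T = k + 1 := ⟨T / 2 + l * T - 1, by omega⟩
    rw [hk] at s1 s2 heven ⊢
    have hn := hnorm k
    rw [heven.neg_one_pow, one_mul, s2, hva] at hn
    refine ⟨?_, hPpos k, hQpos k, hn⟩
    rw [(hrel k).1, s1, s2, ← hva]
    exact dvd_add (hdvd.mul_right _) (dvd_mul_right _ _)
  have hback : ∀ x y p q : ℤ, a * x = p → y = q → p ^ 2 - d * q ^ 2 = a →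
      (a : ℤ) * x ^ 2 - b * y ^ 2 = 1 := by
    rintro x y p q rfl rfl h
    refine mul_left_cancel₀ ha0.ne' ?_
    rw [hdab'] at h
    linear_combination h
  refine ⟨⟨?_, ?_⟩, ?_⟩
  · rintro ⟨x, y, hxy⟩
    obtain ⟨hT4, l, h1, h2, -⟩ := hsol x y hxy
    obtain ⟨s1, s2⟩ := hE.state_add_mul hstate.1 hstate.2 (T / 2) l
    rw [s2] at h1 h2
    rw [s1] at h2
    exact ⟨hT4, h1, h2⟩
  · rintro ⟨hT4, hva, hdvd⟩
    obtain ⟨⟨x, hx⟩, hp, hq, hn⟩ := hconv hT4 hva hdvd 0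
    have hx0 : 0 ≤ x := by
      rw [hx] at hp
      exact (pos_of_mul_pos_right hp ha0.le).le
    lift x to ℕ using hx0
    obtain ⟨y, hy⟩ := Int.eq_ofNat_of_zero_le hq.le
    exact ⟨x, y, hback _ _ _ _ hx.symm hy.symm hn⟩
  · rintro ⟨hT4, hva, hdvd⟩ x y
    constructor
    · intro hxy
      obtain ⟨-, l, -, -, h1, h2⟩ := hsol x y hxy
      exact ⟨l, ⟨x, h1.symm⟩, h1, h2⟩
    · rintro ⟨l, -, h1, h2⟩
      exact hback _ _ _ _ h1 h2 (hconv hT4 hva hdvd l).2.2.2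
end

section
/- Let a and b be nonzero integers and n an integer with n ≥ 3. Then the equation a·x^n − b·y^n = 1 has only finitely many solutions (x, y) ∈ ℤ²; i.e. the set { (x, y) ∈ ℤ × ℤ : a·x^n − b·y^n = 1 } is finite. -/
open Finset Polynomial
/-- The generalized binomial coefficient `s choose k` of a real number `s`. -/
noncomputable def realChoose (s : ℝ) (k : ℕ) : ℝ := (∏ i ∈ range k, (s - i)) / k.factorial

/-- The coefficient of `t ^ k` in the numerator of the `[r/r]` Padé approximant of `t ^ ν`
at `t = 1`; the denominator has the coefficients `padeCoeff (-ν) r k`. -/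
noncomputable def padeCoeff (ν : ℝ) (r k : ℕ) : ℝ :=
  realChoose (r + ν) k * realChoose (r - ν) (r - k)

theorem prod_erase_range_natCast_sub {r k : ℕ} (hk : k ≤ r) :
    ∏ i ∈ (range (r + 1)).erase k, ((k : ℝ) - i)
      = (-1) ^ (r - k) * k.factorial * (r - k).factorial := by
  obtain ⟨m, rfl⟩ := Nat.exists_eq_add_of_le hk
  have h1 : (range (k + m + 1)).erase k
      = range k ∪ (range m).image (fun i => k + 1 + i) := by
    ext x
    simp only [mem_erase, mem_range, mem_union, mem_image]
    constructor
    · intro h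
      by_cases hx : x < k
      · exact Or.inl hx
      · exact Or.inr ⟨x - k - 1, by omega, by omega⟩
    · rintro (h | ⟨i, hi, rfl⟩) <;> omega
  rw [h1, prod_union, prod_image (by intro x _ y _ h; simpa using h)]
  · have h2 : ∏ i ∈ range k, ((k : ℝ) - i) = k.factorial := by
      rw [← prod_range_reflect, ← prod_range_add_one_eq_factorial]
      push_cast
      refine prod_congr rfl fun i hi => ?_
      have := mem_range.1 hi
      rw [Nat.cast_sub (by omega), Nat.cast_sub (by omega)]
      push_cast; ring
    have h3 : ∏ i ∈ range m, ((k : ℝ) - ((k + 1 + i : ℕ) : ℝ)) = (-1) ^ m * m.factorial := by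
      rw [← prod_range_add_one_eq_factorial]
      push_cast
      rw [← card_range m, ← prod_const, card_range, ← prod_mul_distrib]
      refine prod_congr rfl fun i hi => ?_
      ring
    rw [h2, h3, Nat.add_sub_cancel_left]; ring
  · rw [disjoint_left]
    intro x hx hx'
    simp only [mem_image, mem_range] at hx hx'
    omega

theorem padeCoeff_mul_prod (ν : ℝ) {r k : ℕ} (hk : k ≤ r) :
    padeCoeff ν r k * ((∏ i ∈ (range (r + 1)).erase k, ((k : ℝ) - i)) *
        ∏ i ∈ range (r + 1), ((k : ℝ) - (i + ν)))
      = -((∏ i ∈ range r, (i + 1 - ν)) * ∏ i ∈ range (r + 1), (i + ν)) := by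
  rw [prod_erase_range_natCast_sub hk]
  obtain ⟨m, rfl⟩ := Nat.exists_eq_add_of_le hk
  unfold padeCoeff realChoose
  rw [Nat.add_sub_cancel_left]
  have h1 : ∏ i ∈ range (k + m + 1), ((k : ℝ) - (i + ν))
      = (∏ i ∈ range k, (i + 1 - ν)) * ((-1) ^ (m + 1) * ∏ i ∈ range (m + 1), (i + ν)) := by
    rw [add_assoc, prod_range_add]
    congr 1
    · rw [← prod_range_reflect]
      refine prod_congr rfl fun i hi => ?_
      have := mem_range.1 hi
      rw [Nat.cast_sub (by omega), Nat.cast_sub (by omega)]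
      push_cast; ring
    · rw [← card_range (m + 1), ← prod_const, card_range, ← prod_mul_distrib]
      refine prod_congr rfl fun i hi => ?_
      push_cast; ring
  have h2 : ∏ i ∈ range (k + m), ((i : ℝ) + 1 - ν)
      = (∏ i ∈ range k, (i + 1 - ν)) * ∏ i ∈ range m, ((k + m : ℕ) - ν - i) := by
    rw [prod_range_add]
    congr 1
    rw [← prod_range_reflect]
    refine prod_congr rfl fun i hi => ?_
    have := mem_range.1 hi
    rw [Nat.cast_add, Nat.cast_sub (by omega), Nat.cast_sub (by omega)]
    push_cast; ring
  have h3 : ∏ i ∈ range (k + m + 1), ((i : ℝ) + ν)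
      = (∏ i ∈ range (m + 1), (i + ν)) * ∏ i ∈ range k, ((k + m : ℕ) + ν - i) := by
    rw [show k + m + 1 = (m + 1) + k by ring, prod_range_add]
    congr 1
    rw [← prod_range_reflect]
    refine prod_congr rfl fun i hi => ?_
    have := mem_range.1 hi
    rw [Nat.cast_add, Nat.cast_sub (by omega), Nat.cast_sub (by omega)]
    push_cast; ring
  rw [h1, h2, h3]
  have := Nat.cast_ne_zero (R := ℝ).2 k.factorial_ne_zero
  have := Nat.cast_ne_zero (R := ℝ).2 m.factorial_ne_zero
  have hs : ((-1 : ℝ)) ^ m * (-1) ^ (m + 1) = -1 := by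
    rw [← pow_add]; exact Odd.neg_one_pow ⟨m, by ring⟩
  field_simp
  linear_combination (∏ i ∈ range k, ((i : ℝ) + 1 - ν)) * (∏ i ∈ range (m + 1), (i + ν)) *
    (∏ i ∈ range k, (((k + m : ℕ) : ℝ) + ν - i)) *
    (∏ i ∈ range m, (((k + m : ℕ) : ℝ) - ν - i)) * hs

theorem sum_padeCoeff_mul_eval {ν : ℝ} (h0 : 0 < ν) (h1 : ν < 1) (r : ℕ) {p : ℝ[X]}
    (hp : p.natDegree ≤ 2 * r) :
    ∑ k ∈ range (r + 1), padeCoeff ν r k * p.eval (k : ℝ)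
      = ∑ k ∈ range (r + 1), padeCoeff (-ν) r k * p.eval (k + ν) := by
  set s : Finset (ℕ ⊕ ℕ) := (range (r + 1)).disjSum (range (r + 1))
  set v : ℕ ⊕ ℕ → ℝ := Sum.elim (fun k => (k : ℝ)) (fun k => k + ν)
  have hcard : #s = 2 * r + 2 := by simp [s, card_disjSum]; ring
  have hne : ∀ i j : ℕ, (i : ℝ) ≠ j + ν := by
    intro i j h
    have h2 : (j : ℝ) < i := by linarith
    have h3 : (i : ℝ) < (j + 1 : ℕ) := by push_cast; linarith
    rw [Nat.cast_lt] at h2 h3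
    omega
  have hv : Set.InjOn v s := by
    rintro (i | i) - (j | j) - h
    · simpa [v] using h
    · exact absurd h (hne i j)
    · exact absurd h.symm (hne j i)
    · simpa [v] using h
  have key := Lagrange.coeff_eq_sum hv (P := p)
    (by rw [hcard]; exact degree_le_natDegree.trans_lt (by exact_mod_cast (by omega)))
  have hl : ∀ k, s.erase (Sum.inl k) = ((range (r + 1)).erase k).disjSum (range (r + 1)) := by
    intro k; ext (x | x) <;> simp [s]
  have hr : ∀ k, s.erase (Sum.inr k) = (range (r + 1)).disjSum ((range (r + 1)).erase k) := by
    intro k; ext (x | x) <;> simp [s]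
  rw [hcard, coeff_eq_zero_of_natDegree_lt (by omega), sum_disjSum] at key
  set K : ℝ := -((∏ i ∈ range r, (i + 1 - ν)) * ∏ i ∈ range (r + 1), (i + ν)) with hK
  have hK' : -((∏ i ∈ range r, ((i : ℝ) + 1 - -ν)) * ∏ i ∈ range (r + 1), ((i : ℝ) + -ν)) = -K := by
    rw [hK, prod_range_succ', prod_range_succ' (fun i : ℕ => (i : ℝ) + ν)]
    have e1 : ∏ i ∈ range r, ((i : ℝ) + 1 - -ν) = ∏ i ∈ range r, (((i + 1 : ℕ) : ℝ) + ν) :=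
      prod_congr rfl fun i _ => by push_cast; ring
    have e2 : ∏ i ∈ range r, (((i + 1 : ℕ) : ℝ) + -ν) = ∏ i ∈ range r, ((i : ℝ) + 1 - ν) :=
      prod_congr rfl fun i _ => by push_cast; ring
    rw [e1, e2]; push_cast; ring
  have hA : ∀ k ∈ range (r + 1), padeCoeff ν r k * p.eval (k : ℝ)
      = K * (p.eval (v (Sum.inl k)) / ∏ j ∈ s.erase (Sum.inl k), (v (Sum.inl k) - v j)) := by
    intro k hk
    have h := padeCoeff_mul_prod ν (Nat.lt_succ_iff.1 (mem_range.1 hk))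
    have hd : ∏ j ∈ s.erase (Sum.inl k), (v (Sum.inl k) - v j) ≠ 0 :=
      prod_ne_zero_iff.2 fun j hj => sub_ne_zero.2 fun e =>
        (mem_erase.1 hj).1 (hv (by simpa [s] using hk) (mem_erase.1 hj).2 e).symm
    rw [← hK] at h
    rw [← mul_div_assoc, eq_div_iff hd, ← h, hl, prod_disjSum]
    simp only [v, Sum.elim_inl, Sum.elim_inr]
    ring
  have hB : ∀ k ∈ range (r + 1), padeCoeff (-ν) r k * p.eval (k + ν)
      = -K * (p.eval (v (Sum.inr k)) / ∏ j ∈ s.erase (Sum.inr k), (v (Sum.inr k) - v j)) := by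
    intro k hk
    have h := padeCoeff_mul_prod (-ν) (Nat.lt_succ_iff.1 (mem_range.1 hk))
    have hd : ∏ j ∈ s.erase (Sum.inr k), (v (Sum.inr k) - v j) ≠ 0 :=
      prod_ne_zero_iff.2 fun j hj => sub_ne_zero.2 fun e =>
        (mem_erase.1 hj).1 (hv (by simpa [s] using hk) (mem_erase.1 hj).2 e).symm
    rw [hK'] at h
    rw [← mul_div_assoc, eq_div_iff hd, ← h, hr, prod_disjSum]
    simp only [v, Sum.elim_inl, Sum.elim_inr]
    have e1 : ∏ i ∈ range (r + 1), ((k : ℝ) - (i + -ν)) = ∏ i ∈ range (r + 1), (k + ν - i) :=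
      prod_congr rfl fun i _ => by ring
    have e2 : ∏ i ∈ (range (r + 1)).erase k, ((k : ℝ) + ν - (i + ν))
        = ∏ i ∈ (range (r + 1)).erase k, ((k : ℝ) - i) :=
      prod_congr rfl fun i _ => by ring
    rw [e1, e2]; ring
  rw [sum_congr rfl hA, sum_congr rfl hB, ← mul_sum, ← mul_sum]
  linear_combination -K * key

theorem sum_padeCoeff_mul_choose {n : ℕ} (hn : 2 ≤ n) {r m : ℕ} (hm : m ≤ 2 * r) :
    ∑ k ∈ range (r + 1), padeCoeff (1 / n) r k * ((n * k).choose m : ℝ)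
      = ∑ k ∈ range (r + 1), padeCoeff (-(1 / n)) r k * ((n * k + 1).choose m : ℝ) := by
  have hn0 : (0 : ℝ) < n := by positivity
  have hn1 : (1 : ℝ) / n < 1 := by
    rw [div_lt_one hn0]; exact_mod_cast (by omega : 1 < n)
  have h := sum_padeCoeff_mul_eval (by positivity) hn1 r
    (p := (descPochhammer ℝ m).comp (C (n : ℝ) * X)) (by
      rw [natDegree_comp, descPochhammer_natDegree]
      calc m * _ ≤ m * 1 := Nat.mul_le_mul_left _ ((natDegree_C_mul_le _ _).trans natDegree_X_le)
        _ ≤ _ := by omega)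
  have hev : ∀ N : ℕ, (descPochhammer ℝ m).eval (N : ℝ) = m.factorial * (N.choose m : ℝ) := by
    intro N
    rw [descPochhammer_eval_eq_descFactorial, Nat.descFactorial_eq_factorial_mul_choose]
    push_cast; rfl
  have e1 : ∀ k : ℕ, ((descPochhammer ℝ m).comp (C (n : ℝ) * X)).eval (k : ℝ)
      = m.factorial * ((n * k).choose m : ℝ) := by
    intro k
    rw [← hev]; simp
  have e2 : ∀ k : ℕ, ((descPochhammer ℝ m).comp (C (n : ℝ) * X)).eval (k + 1 / n : ℝ)
      = m.factorial * ((n * k + 1).choose m : ℝ) := by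
    intro k
    rw [← hev]; simp; congr 1; field_simp
  simp only [e1, e2, mul_left_comm _ (m.factorial : ℝ), ← mul_sum] at h
  exact mul_left_cancel₀ (Nat.cast_ne_zero.2 m.factorial_ne_zero) h

theorem abs_sum_mul_one_add_pow_le {ι : Type*} {s : Finset ι} {c : ι → ℝ} {d : ι → ℕ} {M : ℕ}
    (h : ∀ m < M, ∑ i ∈ s, c i * ((d i).choose m : ℝ) = 0) {w : ℝ} (hw : |w| ≤ 1) :
    |∑ i ∈ s, c i * (1 + w) ^ d i| ≤ |w| ^ M * ∑ i ∈ s, |c i| * 2 ^ d i := by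
  set N := s.sup d
  have hpow : ∀ i ∈ s, ∀ x : ℝ,
      (1 + x) ^ d i = ∑ m ∈ range (N + 1), x ^ m * ((d i).choose m : ℝ) := by
    intro i hi x
    rw [add_comm, add_pow]
    simp only [one_pow, mul_one]
    refine sum_subset (range_subset_range.2 (by have := le_sup (f := d) hi; omega)) ?_
    intro m _ hm
    rw [Nat.choose_eq_zero_of_lt (by simpa using hm)]; simp
  have hL : ∑ i ∈ s, c i * (1 + w) ^ d i
      = ∑ m ∈ range (N + 1), w ^ m * ∑ i ∈ s, c i * ((d i).choose m : ℝ) := by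
    rw [sum_congr rfl fun i hi => by rw [hpow i hi w]]
    simp only [mul_sum]
    rw [sum_comm]
    exact sum_congr rfl fun m _ => sum_congr rfl fun i _ => by ring
  have hR : ∑ i ∈ s, |c i| * 2 ^ d i
      = ∑ m ∈ range (N + 1), ∑ i ∈ s, |c i| * ((d i).choose m : ℝ) := by
    rw [sum_comm]
    refine sum_congr rfl fun i hi => ?_
    rw [← mul_sum, show (2 : ℝ) = 1 + 1 by norm_num, hpow i hi 1]
    simp
  rw [hL, hR, mul_sum]
  refine (abs_sum_le_sum_abs _ _).trans (sum_le_sum fun m _ => ?_)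
  by_cases hm : m < M
  · rw [h m hm]; simp; positivity
  · rw [abs_mul, abs_pow]
    refine mul_le_mul (pow_le_pow_of_le_one (abs_nonneg _) hw (not_lt.1 hm)) ?_ (abs_nonneg _)
      (by positivity)
    refine (abs_sum_le_sum_abs _ _).trans (sum_le_sum fun i _ => ?_)
    rw [abs_mul, Nat.abs_cast]

theorem X_sub_one_pow_dvd_sum {ι : Type*} {s : Finset ι} {c : ι → ℝ} {d : ι → ℕ} {M : ℕ}
    (h : ∀ m < M, ∑ i ∈ s, c i * ((d i).choose m : ℝ) = 0) :
    (X - C (1 : ℝ)) ^ M ∣ ∑ i ∈ s, C (c i) * X ^ d i := by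
  rw [X_sub_C_pow_dvd_iff, X_pow_dvd_iff]
  intro m hm
  rw [← h m hm]
  simp [Polynomial.sum_comp, finsetSum_coeff, coeff_C_mul, coeff_X_add_one_pow]

theorem factorial_dvd_pow_mul_prod (n : ℕ) (s : ℤ) (k : ℕ) :
    (k.factorial : ℤ) ∣ n ^ k * ∏ i ∈ range k, (s - n * i) := by
  rw [Int.natCast_dvd, Nat.dvd_iff_prime_pow_dvd_dvd]
  intro p e hp hpe
  rw [← Int.natCast_dvd]
  by_cases hpn : p ∣ n
  · refine Dvd.dvd.mul_right ?_ _
    have he : e ≤ k := by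
      rcases Nat.eq_zero_or_pos k with rfl | hk
      · by_contra! h
        have := hp.one_lt
        have h1 : p ^ e = 1 := Nat.dvd_one.1 (by simpa using hpe)
        have := (Nat.pow_eq_one.1 h1); omega
      · have := Fact.mk hp
        have h1 := (padicValNat_dvd_iff_le k.factorial_ne_zero).1 hpe
        have h2 := padicValNat_factorial_lt_of_ne_zero p hk.ne'
        omega
    exact_mod_cast (pow_dvd_pow p he).trans (pow_dvd_pow_of_dvd hpn k)
  · refine Dvd.dvd.mul_left ?_ _
    have hcop : IsCoprime (n : ℤ) ((p ^ e : ℕ) : ℤ) :=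
      Nat.isCoprime_iff_coprime.2 (((Nat.Prime.coprime_iff_not_dvd hp).2 hpn).symm.pow_right e)
    obtain ⟨u, v, huv⟩ := hcop
    have hmod : n ^ k * ∏ i ∈ range k, (u * s - i)
        ≡ ∏ i ∈ range k, (s - n * i) [ZMOD ((p ^ e : ℕ) : ℤ)] := by
      rw [← card_range k, ← prod_const, card_range, ← prod_mul_distrib]
      refine Int.ModEq.prod fun i _ => ?_
      refine (Int.modEq_iff_dvd.2 ⟨v * s, ?_⟩)
      linear_combination (-s) * huv
    rw [← hmod.dvd_iff]
    refine Dvd.dvd.mul_left ((Int.natCast_dvd_natCast.2 hpe).trans ?_) _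
    have := Nat.factorial_coe_dvd_prod k (u * s - k + 1)
    rw [← prod_range_reflect] at this
    refine this.trans (dvd_of_eq (prod_congr rfl fun i hi => ?_))
    have := mem_range.1 hi
    rw [Nat.cast_sub (by omega), Nat.cast_sub (by omega)]
    push_cast; ring

theorem exists_int_eq_pow_mul_realChoose {n : ℕ} (hn : n ≠ 0) (s : ℤ) (k : ℕ) :
    ∃ z : ℤ, (n : ℝ) ^ (2 * k) * realChoose (s / n) k = z := by
  obtain ⟨z, hz⟩ := factorial_dvd_pow_mul_prod n s k
  refine ⟨z, ?_⟩
  have hn0 : (n : ℝ) ≠ 0 := Nat.cast_ne_zero.2 hn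
  have hk := Nat.cast_ne_zero (R := ℝ).2 k.factorial_ne_zero
  have h : (n : ℝ) ^ k * ∏ i ∈ range k, ((s : ℝ) - n * i) = k.factorial * z := by
    exact_mod_cast congrArg (Int.cast (R := ℝ)) hz
  have h2 : (n : ℝ) ^ k * ∏ i ∈ range k, ((s : ℝ) / n - i) = ∏ i ∈ range k, ((s : ℝ) - n * i) := by
    conv_lhs => rw [← card_range k, ← prod_const, card_range, ← prod_mul_distrib]
    exact prod_congr rfl fun i _ => by field_simp
  rw [realChoose, mul_div_assoc', div_eq_iff hk, mul_comm (z : ℝ), ← h, ← h2]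
  ring

theorem realChoose_nonneg_and_le {s : ℝ} {r k : ℕ} (hs : (r : ℝ) - 1 ≤ s) (hs' : s ≤ r + 1)
    (hk : k ≤ r) : 0 ≤ realChoose s k ∧ realChoose s k ≤ 2 ^ (r + 1) := by
  have hf : (0 : ℝ) < k.factorial := by positivity
  have h0 : ∀ i ∈ range k, 0 ≤ s - i := fun i hi => by
    have : ((i + 1 : ℕ) : ℝ) ≤ r := Nat.cast_le.2 (by have := mem_range.1 hi; omega)
    push_cast at this; linarith
  refine ⟨div_nonneg (prod_nonneg h0) hf.le, ?_⟩
  have h1 : ∏ i ∈ range k, (s - i) ≤ (r + 1).descFactorial k := by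
    rw [Nat.descFactorial_eq_prod_range]
    push_cast
    refine prod_le_prod h0 fun i hi => ?_
    rw [Nat.cast_sub (by have := mem_range.1 hi; omega)]
    push_cast; linarith
  rw [realChoose, div_le_iff₀ hf]
  refine h1.trans ?_
  rw [Nat.descFactorial_eq_factorial_mul_choose, mul_comm]
  push_cast
  gcongr
  exact_mod_cast Nat.choose_le_two_pow (r + 1) k

theorem padeCoeff_nonneg_and_le {ν : ℝ} (hν : |ν| ≤ 1) {r k : ℕ} (hk : k ≤ r) :
    0 ≤ padeCoeff ν r k ∧ padeCoeff ν r k ≤ 4 ^ (r + 1) := by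
  obtain ⟨h1, h2⟩ := abs_le.1 hν
  obtain ⟨a0, a1⟩ := realChoose_nonneg_and_le (s := r + ν) (r := r) (by linarith) (by linarith) hk
  obtain ⟨b0, b1⟩ := realChoose_nonneg_and_le (s := r - ν) (r := r) (by linarith) (by linarith)
    (Nat.sub_le r k)
  refine ⟨mul_nonneg a0 b0, (mul_le_mul a1 b1 b0 (by positivity)).trans_eq ?_⟩
  rw [← mul_pow]; norm_num

theorem exists_int_eq_pow_mul_padeCoeff {n : ℕ} (hn : n ≠ 0) (e : ℤ) {r k : ℕ} (hk : k ≤ r) :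
    ∃ z : ℤ, (n : ℝ) ^ (2 * r) * padeCoeff (e / n) r k = z := by
  obtain ⟨z, hz⟩ := exists_int_eq_pow_mul_realChoose hn (r * n + e) k
  obtain ⟨w, hw⟩ := exists_int_eq_pow_mul_realChoose hn (r * n - e) (r - k)
  refine ⟨z * w, ?_⟩
  have hn0 : (n : ℝ) ≠ 0 := Nat.cast_ne_zero.2 hn
  push_cast at hz hw ⊢
  rw [add_div, mul_div_cancel_right₀ _ hn0] at hz
  rw [sub_div, mul_div_cancel_right₀ _ hn0] at hw
  rw [← hz, ← hw, padeCoeff, show 2 * r = 2 * k + 2 * (r - k) by omega, pow_add]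
  ring

/-- The numerator of the `[r/r]` Padé approximant of `t ^ ν` at `t = 1`. -/
noncomputable def padePoly (ν : ℝ) (r : ℕ) : ℝ[X] :=
  ∑ k ∈ range (r + 1), C (padeCoeff ν r k) * X ^ k

theorem eval_padePoly (ν : ℝ) (r : ℕ) (t : ℝ) :
    (padePoly ν r).eval t = ∑ k ∈ range (r + 1), padeCoeff ν r k * t ^ k := by
  simp [padePoly, eval_finsetSum]

theorem natDegree_padePoly_le (ν : ℝ) (r : ℕ) : (padePoly ν r).natDegree ≤ r :=
  natDegree_sum_le_of_forall_le _ _ fun _ hk =>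
    (natDegree_C_mul_X_pow_le _ _).trans (Nat.lt_succ_iff.1 (mem_range.1 hk))

theorem abs_eval_padePoly_le {ν : ℝ} (hν : |ν| ≤ 1) (r : ℕ) {t : ℝ} (ht : |t| ≤ 2) :
    |(padePoly ν r).eval t| ≤ 4 * 16 ^ r := by
  rw [eval_padePoly]
  have h : ∀ k ∈ range (r + 1), |padeCoeff ν r k * t ^ k| ≤ 4 ^ (r + 1) * 2 ^ r := fun k hk => by
    have hk' := Nat.lt_succ_iff.1 (mem_range.1 hk)
    obtain ⟨h0, h1⟩ := padeCoeff_nonneg_and_le hν hk'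
    rw [abs_mul, abs_of_nonneg h0, abs_pow]
    gcongr
    exact (pow_le_pow_left₀ (abs_nonneg _) ht _).trans (pow_le_pow_right₀ (by norm_num) hk')
  refine (abs_sum_le_sum_abs _ _).trans ((sum_le_sum h).trans ?_)
  rw [sum_const, card_range, nsmul_eq_mul]
  have : ((r + 1 : ℕ) : ℝ) ≤ 2 ^ r := by exact_mod_cast Nat.lt_two_pow_self
  calc ((r + 1 : ℕ) : ℝ) * (4 ^ (r + 1) * 2 ^ r) ≤ 2 ^ r * (4 ^ (r + 1) * 2 ^ r) := by gcongr
    _ = 4 * (2 * 4 * 2) ^ r := by rw [mul_pow, mul_pow]; ring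
    _ = _ := by norm_num

theorem sum_disjSum_padeCoeff {M : Type*} [AddCommMonoid M] (n r : ℕ) (f : ℝ → ℕ → M) :
    ∑ i ∈ (range (r + 1)).disjSum (range (r + 1)),
        f (Sum.elim (padeCoeff (1 / n) r) (fun k => -padeCoeff (-(1 / n)) r k) i)
          (Sum.elim (fun k => n * k) (fun k => n * k + 1) i)
      = ∑ k ∈ range (r + 1), f (padeCoeff (1 / n) r k) (n * k)
        + ∑ k ∈ range (r + 1), f (-padeCoeff (-(1 / n)) r k) (n * k + 1) := by
  rw [sum_disjSum]; rfl

theorem sum_disjSum_padeCoeff_mul_choose {n : ℕ} (hn : 2 ≤ n) (r : ℕ) :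
    ∀ m < 2 * r + 1, ∑ i ∈ (range (r + 1)).disjSum (range (r + 1)),
        (Sum.elim (padeCoeff (1 / n) r) (fun k => -padeCoeff (-(1 / n)) r k) i)
          * ((Sum.elim (fun k => n * k) (fun k => n * k + 1) i).choose m : ℝ) = 0 := by
  intro m hm
  rw [sum_disjSum_padeCoeff n r fun c d => c * (d.choose m : ℝ),
    sum_padeCoeff_mul_choose hn (Nat.lt_succ_iff.1 hm)]
  simp

theorem X_sub_one_pow_dvd_padePoly_comp {n : ℕ} (hn : 2 ≤ n) (r : ℕ) :
    (X - C (1 : ℝ)) ^ (2 * r + 1) ∣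
      (padePoly (1 / n) r).comp (X ^ n) - X * (padePoly (-(1 / n)) r).comp (X ^ n) := by
  convert X_sub_one_pow_dvd_sum (sum_disjSum_padeCoeff_mul_choose hn r) using 1
  rw [sum_disjSum_padeCoeff n r fun c d => C c * X ^ d]
  simp [padePoly, Polynomial.sum_comp, mul_sum, sub_eq_add_neg, pow_mul, pow_succ]
  exact sum_congr rfl fun k _ => by ring

theorem abs_eval_padePoly_sub_le {n : ℕ} (hn : 2 ≤ n) (r : ℕ) {u : ℝ} (hu : |u - 1| ≤ 1) :
    |(padePoly (1 / n) r).eval (u ^ n) - u * (padePoly (-(1 / n)) r).eval (u ^ n)|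
      ≤ |u - 1| ^ (2 * r + 1) * (16 * 2 ^ ((n + 3) * r)) := by
  have hν : |1 / (n : ℝ)| ≤ 1 := by
    rw [abs_of_nonneg (by positivity)]
    exact div_le_one_of_le₀ (by exact_mod_cast (by omega : 1 ≤ n)) (by positivity)
  have h := abs_sum_mul_one_add_pow_le (sum_disjSum_padeCoeff_mul_choose hn r) hu
  rw [sum_disjSum_padeCoeff n r fun c d => c * (1 + (u - 1)) ^ d,
    sum_disjSum_padeCoeff n r fun c d => |c| * 2 ^ d] at h
  have e : (padePoly (1 / n) r).eval (u ^ n) - u * (padePoly (-(1 / n)) r).eval (u ^ n)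
      = ∑ k ∈ range (r + 1), padeCoeff (1 / n) r k * (1 + (u - 1)) ^ (n * k)
        + ∑ k ∈ range (r + 1), -padeCoeff (-(1 / n)) r k * (1 + (u - 1)) ^ (n * k + 1) := by
    rw [eval_padePoly, eval_padePoly, sub_eq_add_neg, mul_sum, ← sum_neg_distrib]
    simp only [add_sub_cancel, ← pow_mul, pow_succ]
    congr 1
    exact sum_congr rfl fun k _ => by ring
  rw [e]
  refine h.trans (mul_le_mul_of_nonneg_left ?_ (by positivity))
  have h1 : ∀ (ν : ℝ) (_ : |ν| ≤ 1) (j : ℕ) (_ : j ≤ 1), ∑ k ∈ range (r + 1),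
      |padeCoeff ν r k| * 2 ^ (n * k + j) ≤ 8 * 2 ^ ((n + 3) * r) := by
    intro ν hν j hj
    have h2 : ∀ k ∈ range (r + 1), |padeCoeff ν r k| * 2 ^ (n * k + j)
        ≤ 4 ^ (r + 1) * 2 ^ (n * r + 1) := fun k hk => by
      have hk' := Nat.lt_succ_iff.1 (mem_range.1 hk)
      obtain ⟨h0, h1⟩ := padeCoeff_nonneg_and_le hν hk'
      rw [abs_of_nonneg h0]
      gcongr
      norm_num
    refine (sum_le_sum h2).trans ?_
    rw [sum_const, card_range, nsmul_eq_mul]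
    have : ((r + 1 : ℕ) : ℝ) ≤ 2 ^ r := by exact_mod_cast Nat.lt_two_pow_self
    calc ((r + 1 : ℕ) : ℝ) * (4 ^ (r + 1) * 2 ^ (n * r + 1))
        ≤ 2 ^ r * (4 ^ (r + 1) * 2 ^ (n * r + 1)) := by gcongr
      _ = 8 * 2 ^ ((n + 3) * r) := by
        rw [show (4 : ℝ) = 2 ^ 2 by norm_num, ← pow_mul]; ring
  have hA := h1 _ hν 0 (by norm_num)
  have hB := h1 (-(1 / n)) (by rwa [abs_neg]) 1 le_rfl
  simp only [abs_neg, add_zero] at hA hB ⊢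
  linarith

theorem isCoprime_X_sub_one_pow {p : ℝ[X]} (hp : p.eval 1 ≠ 0) (M : ℕ) :
    IsCoprime ((X - C (1 : ℝ)) ^ M) p :=
  (((irreducible_X_sub_C 1).coprime_iff_not_dvd).2 fun h => hp (dvd_iff_isRoot.1 h)).pow_left

theorem X_sub_one_pow_dvd_of_dvd_comp {n : ℕ} (hn : n ≠ 0) {M : ℕ} {p : ℝ[X]}
    (h : (X - C (1 : ℝ)) ^ M ∣ p.comp (X ^ n)) : (X - C (1 : ℝ)) ^ M ∣ p := by
  induction M generalizing p with
  | zero => simp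
  | succ M ih =>
    have h1 : (X - C (1 : ℝ)) ∣ p := by
      rw [dvd_iff_isRoot]
      have := dvd_iff_isRoot.1 ((dvd_pow_self _ M.succ_ne_zero).trans h)
      simpa [IsRoot] using this
    obtain ⟨q, rfl⟩ := h1
    rw [pow_succ']
    refine mul_dvd_mul_left _ (ih ?_)
    have hg : (X - C (1 : ℝ)) * (∑ i ∈ range n, (X : ℝ[X]) ^ i) = X ^ n - C 1 := by
      rw [mul_comm, map_one, geom_sum_mul]
    rw [mul_comp, sub_comp, X_comp, C_comp, ← hg, pow_succ', mul_assoc,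
      mul_dvd_mul_iff_left (X_sub_C_ne_zero 1)] at h
    refine (isCoprime_X_sub_one_pow ?_ M).dvd_of_dvd_mul_left h
    simpa [eval_finsetSum] using hn

theorem realChoose_add_one_succ (s : ℝ) (k : ℕ) :
    realChoose (s + 1) (k + 1) = (s + 1) / (k + 1) * realChoose s k := by
  have := Nat.cast_ne_zero (R := ℝ).2 k.factorial_ne_zero
  rw [realChoose, realChoose, prod_range_succ', Nat.factorial_succ]
  have : ∏ i ∈ range k, (s + 1 - ((i + 1 : ℕ) : ℝ)) = ∏ i ∈ range k, (s - i) :=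
    prod_congr rfl fun i _ => by push_cast; ring
  rw [this]
  push_cast
  field_simp
  ring

theorem realChoose_add_ne_zero {ν : ℝ} (hν : |ν| < 1) (r : ℕ) : realChoose (r + ν) r ≠ 0 := by
  refine div_ne_zero (prod_ne_zero_iff.2 fun i hi => ?_)
    (Nat.cast_ne_zero.2 r.factorial_ne_zero)
  have : ((i + 1 : ℕ) : ℝ) ≤ r := Nat.cast_le.2 (mem_range.1 hi)
  push_cast at this
  have := (abs_lt.1 hν).1
  exact (by linarith : (0 : ℝ) < r + ν - i).ne'

theorem eval_zero_padePoly (ν : ℝ) (r : ℕ) :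
    (padePoly ν r).eval 0 = realChoose (r + -ν) r := by
  rw [eval_padePoly, sum_range_succ', sum_eq_zero fun k _ => by simp]
  simp [padeCoeff, realChoose, sub_eq_add_neg]

theorem eval_padePoly_mul_ne {n : ℕ} (hn : 2 ≤ n) (r : ℕ) {t : ℝ} (ht : t ≠ 1) :
    (padePoly (1 / n) r).eval t * (padePoly (-(1 / n)) (r + 1)).eval t
      ≠ (padePoly (1 / n) (r + 1)).eval t * (padePoly (-(1 / n)) r).eval t := by
  have hn0 : (0 : ℝ) < n := by positivity
  have hν : |1 / (n : ℝ)| < 1 := by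
    rw [abs_of_nonneg (by positivity), div_lt_one hn0]; exact_mod_cast (by omega : 1 < n)
  obtain ⟨ν, hνdef⟩ : ∃ ν : ℝ, ν = 1 / n := ⟨_, rfl⟩
  have hν0 : 0 < ν := by rw [hνdef]; positivity
  have dvd₀ := X_sub_one_pow_dvd_padePoly_comp hn r
  have dvd₁ := (pow_dvd_pow _ (by omega)).trans (X_sub_one_pow_dvd_padePoly_comp hn (r + 1))
    (a := (X - C (1 : ℝ)) ^ (2 * r + 1))
  rw [← hνdef] at hν dvd₀ dvd₁ ⊢
  set D : ℝ[X] := padePoly ν r * padePoly (-ν) (r + 1) - padePoly ν (r + 1) * padePoly (-ν) r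
    with hD
  have hdeg : D.natDegree ≤ 2 * r + 1 := by
    have h := fun μ s => natDegree_padePoly_le μ s
    refine (natDegree_sub_le _ _).trans (max_le ?_ ?_) <;> refine natDegree_mul_le.trans ?_
    · have := h ν r; have := h (-ν) (r + 1); omega
    · have := h ν (r + 1); have := h (-ν) r; omega
  have hdvd : (X - C (1 : ℝ)) ^ (2 * r + 1) ∣ D := by
    refine X_sub_one_pow_dvd_of_dvd_comp (by omega : n ≠ 0)
      ((isCoprime_X_sub_one_pow (p := X) (by simp) _).dvd_of_dvd_mul_left ?_)
    have := dvd_sub (dvd₀.mul_left ((padePoly ν (r + 1)).comp (X ^ n)))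
      (dvd₁.mul_left ((padePoly ν r).comp (X ^ n)))
    convert this using 1
    rw [hD, sub_comp, mul_comp, mul_comp]; ring
  have hD0 : D.eval 0 ≠ 0 := by
    have e : D.eval 0 = realChoose (r + -ν) r * realChoose (r + ν) r * (2 * ν / (r + 1)) := by
      rw [hD, eval_sub, eval_mul, eval_mul]
      simp only [eval_zero_padePoly, neg_neg]
      rw [show ((r + 1 : ℕ) : ℝ) + ν = r + ν + 1 by push_cast; ring,
        show ((r + 1 : ℕ) : ℝ) + -ν = r + -ν + 1 by push_cast; ring,
        realChoose_add_one_succ, realChoose_add_one_succ]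
      field_simp
      ring
    rw [e]
    exact mul_ne_zero (mul_ne_zero (realChoose_add_ne_zero (by rwa [abs_neg]) r)
      (realChoose_add_ne_zero hν r)) (by positivity)
  obtain ⟨E, hE⟩ := hdvd
  have hE0 : E ≠ 0 := by rintro rfl; simp [hE] at hD0
  have hEdeg : E.natDegree = 0 := by
    rw [hE, natDegree_mul (pow_ne_zero _ (X_sub_C_ne_zero 1)) hE0, natDegree_pow,
      natDegree_X_sub_C] at hdeg
    omega
  obtain ⟨c, rfl⟩ := natDegree_eq_zero.1 hEdeg
  have hc : c ≠ 0 := by rintro rfl; simp at hE0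
  have : D.eval t ≠ 0 := by
    rw [hE]
    simpa [sub_eq_zero, hc] using fun h => absurd h ht
  rwa [hD, eval_sub, eval_mul, eval_mul, sub_ne_zero] at this

theorem exists_int_eq_mul_eval_padePoly {n : ℕ} (hn : n ≠ 0) (e : ℤ) (r : ℕ) {P Q : ℤ}
    (hQ : Q ≠ 0) :
    ∃ z : ℤ, (n : ℝ) ^ (2 * r) * (Q : ℝ) ^ r * (padePoly (e / n) r).eval ((P : ℝ) / Q) = z := by
  have h : ∀ k, ∃ z : ℤ, k ≤ r → (n : ℝ) ^ (2 * r) * padeCoeff (e / n) r k = z := fun k => by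
    by_cases hk : k ≤ r
    · obtain ⟨z, hz⟩ := exists_int_eq_pow_mul_padeCoeff hn e hk
      exact ⟨z, fun _ => hz⟩
    · exact ⟨0, fun h => absurd h hk⟩
  choose f hf using h
  refine ⟨∑ k ∈ range (r + 1), f k * (P ^ k * Q ^ (r - k)), ?_⟩
  rw [eval_padePoly, mul_sum]
  push_cast
  refine sum_congr rfl fun k hk => ?_
  have hk' := Nat.lt_succ_iff.1 (mem_range.1 hk)
  have hQ' : (Q : ℝ) ≠ 0 := Int.cast_ne_zero.2 hQ
  rw [← hf k hk', ← Nat.sub_add_cancel hk', pow_add (Q : ℝ), Nat.sub_add_cancel hk', div_pow]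
  field_simp

theorem abs_sub_one_le_abs_pow_sub_one {u : ℝ} (hu : 0 ≤ u) {n : ℕ} (hn : n ≠ 0) :
    |u - 1| ≤ |u ^ n - 1| := by
  rcases le_total u 1 with h | h
  · have := pow_le_of_le_one hu h hn
    rw [abs_of_nonpos (by linarith), abs_of_nonpos (by linarith)]
    linarith
  · have := le_self_pow₀ h hn
    rw [abs_of_nonneg (by linarith), abs_of_nonneg (by linarith)]
    linarith

theorem exists_pow_eq_div {n : ℕ} (hn : n ≠ 0) {P Q : ℝ} (hPQ : Q - P = 1) (hQ : 2 ≤ |Q|) :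
    ∃ u : ℝ, 1 / 2 ≤ u ∧ u ≤ 3 / 2 ∧ u ^ n = P / Q ∧ |u ^ n| ≤ 2 ∧
      |u - 1| ≤ 1 / |Q| := by
  have hQ0 : Q ≠ 0 := by rintro rfl; norm_num at hQ
  have ht : |P / Q - 1| = 1 / |Q| := by
    rw [div_sub_one hQ0, abs_div, show P - Q = -1 by linarith]; norm_num
  have hQ' : 1 / |Q| ≤ 1 / 2 := one_div_le_one_div_of_le (by norm_num) hQ
  obtain ⟨hlo, hhi⟩ := abs_le.1 (ht.trans_le hQ')
  have ht0 : 0 ≤ P / Q := by linarith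
  have hu := Real.rpow_inv_natCast_pow ht0 hn
  have hle := abs_sub_one_le_abs_pow_sub_one (Real.rpow_nonneg ht0 (n⁻¹ : ℝ)) hn
  rw [hu, ht] at hle
  have := abs_le.1 (hle.trans hQ')
  exact ⟨_, by linarith, by linarith, hu,
    by rw [hu, abs_of_nonneg ht0]; linarith, hle⟩

/-- The linear form in the absolute values of one solution whose coefficients come from the Padé
approximants evaluated at another solution. -/
noncomputable def padeForm (n r : ℕ) (t α β : ℝ) : ℝ :=
  (padePoly (1 / n) r).eval t * α - (padePoly (-(1 / n)) r).eval t * β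

theorem abs_padeForm_le {n : ℕ} (hn : 2 ≤ n) (r : ℕ) {u v α β δ ε : ℝ}
    (hu : 1 / 2 ≤ u) (hu' : u ≤ 3 / 2) (hun : |u ^ n| ≤ 2) (hv : 1 / 2 ≤ v) (hα : 0 ≤ α)
    (h : α * u = β * v) (hδ : |u - 1| ≤ δ) (hε : |v - 1| ≤ ε) :
    |padeForm n r (u ^ n) α β|
      ≤ α * (δ ^ (2 * r + 1) * (16 * 2 ^ ((n + 3) * r)) + 12 * 16 ^ r * ε) := by
  have hν : |-(1 / (n : ℝ))| ≤ 1 := by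
    rw [abs_neg, abs_of_nonneg (by positivity)]
    exact div_le_one_of_le₀ (by exact_mod_cast (by omega : 1 ≤ n)) (by positivity)
  have hA := abs_eval_padePoly_sub_le hn r (u := u) (abs_le.2 ⟨by linarith, by linarith⟩)
  have hB := abs_eval_padePoly_le hν r hun
  set A := (padePoly (1 / n) r).eval (u ^ n)
  set B := (padePoly (-(1 / n)) r).eval (u ^ n)
  have hv0 : v ≠ 0 := by linarith
  have e : padeForm n r (u ^ n) α β = α * ((A - u * B) + u * B * ((v - 1) / v)) := by
    rw [padeForm, show β = α * u / v by rw [h]; field_simp]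
    field_simp
    ring
  have hw : |(v - 1) / v| ≤ 2 * ε := by
    rw [abs_div, abs_of_pos (by linarith : 0 < v), div_le_iff₀ (by linarith)]
    nlinarith [abs_nonneg (v - 1)]
  have hε0 : 0 ≤ ε := (abs_nonneg _).trans hε
  rw [e, abs_mul, abs_of_nonneg hα]
  refine mul_le_mul_of_nonneg_left ((abs_add_le _ _).trans (add_le_add (hA.trans ?_) ?_)) hα
  · gcongr
  · rw [abs_mul, abs_mul, abs_of_pos (by linarith : 0 < u)]
    calc u * |B| * |(v - 1) / v| ≤ 3 / 2 * (4 * 16 ^ r) * (2 * ε) := by gcongr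
      _ = _ := by ring

theorem padeForm_ne_zero_or {n : ℕ} (hn : 2 ≤ n) (r : ℕ) {t α β : ℝ} (ht : t ≠ 1)
    (hα : α ≠ 0) : padeForm n r t α β ≠ 0 ∨ padeForm n (r + 1) t α β ≠ 0 := by
  by_contra! h
  obtain ⟨h1, h2⟩ := h
  unfold padeForm at h1 h2
  refine eval_padePoly_mul_ne hn r ht (mul_right_cancel₀ hα ?_)
  linear_combination (padePoly (-(1 / n)) (r + 1)).eval t * h1
    - (padePoly (-(1 / n)) r).eval t * h2

theorem exists_pade_order {n h Y C : ℕ} (hn : 3 ≤ n) (hC : 1 ≤ C) (hh : (2 * C) ^ (n + 1) ≤ h)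
    (hY : h ^ (4 * n) ≤ Y) :
    ∃ r, 1 ≤ r ∧ ∀ s, r ≤ s → s ≤ r + 1 →
      C ^ s * (h * Y * (Y ^ n + h ^ (n * (2 * s + 1)))) < h ^ (n * (s + 1)) * Y ^ n := by
  obtain ⟨D, hD⟩ : ∃ D, D = 2 * C := ⟨_, rfl⟩
  rw [← hD] at hh
  have hD2 : 2 ≤ D := by omega
  have hDh : D ≤ h := (Nat.le_self_pow (by omega) D).trans hh
  have hh0 : 0 < h := by omega
  have hY0 : 0 < Y := lt_of_lt_of_le (by positivity) hY
  have hex : ∃ r, D ^ r * Y < h ^ (n * (r + 1) - 1) := by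
    refine ⟨Y, ?_⟩
    calc D ^ Y * Y < h ^ Y * h ^ Y :=
          Nat.mul_lt_mul_of_le_of_lt (Nat.pow_le_pow_left hDh _)
            (Nat.lt_pow_self (by omega)) (by positivity)
      _ = h ^ (Y + Y) := (pow_add _ _ _).symm
      _ ≤ _ := Nat.pow_le_pow_right (by omega) (by
          have : 3 * (Y + 1) ≤ n * (Y + 1) := Nat.mul_le_mul_right _ hn
          omega)
  classical
  set r := Nat.find hex
  have hr : D ^ r * Y < h ^ (n * (r + 1) - 1) := Nat.find_spec hex
  have hr4 : 4 ≤ r := by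
    by_contra! hlt
    have h1 : h ^ (n * (r + 1) - 1) ≤ Y := (Nat.pow_le_pow_right (by omega) (by
      have : n * (r + 1) ≤ n * 4 := Nat.mul_le_mul_left _ (by omega)
      omega)).trans hY
    have h2 : Y ≤ D ^ r * Y := Nat.le_mul_of_pos_left _ (by positivity)
    omega
  have hmin : h ^ (n * r - 1) ≤ D ^ (r - 1) * Y := by
    have := Nat.find_min hex (m := r - 1) (by omega)
    rwa [not_lt, Nat.sub_add_cancel (by omega)] at this
  have hr' : D ^ (r + 1) * Y < h ^ (n * (r + 1 + 1) - 1) := by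
    calc D ^ (r + 1) * Y = D * (D ^ r * Y) := by ring
      _ < D * h ^ (n * (r + 1) - 1) := by gcongr
      _ ≤ h * h ^ (n * (r + 1) - 1) := by gcongr
      _ = h ^ (n * (r + 1) - 1 + 1) := (pow_succ' _ _).symm
      _ ≤ _ := Nat.pow_le_pow_right (by omega) (by
          have : n * (r + 1 + 1) = n * (r + 1) + n := by ring
          omega)
  have hsnd : D ^ (r + 1) * h ^ (n * (r + 1) + 1) < Y ^ (n - 1) := by
    refine lt_of_mul_lt_mul_left' (a := D ^ ((r - 1) * (n - 1))) ?_
    obtain ⟨i, rfl⟩ := Nat.exists_eq_add_of_le hn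
    obtain ⟨j, hj⟩ := Nat.exists_eq_add_of_le hr4
    rw [hj] at hmin ⊢
    have e1 : 4 + j - 1 = 3 + j := by omega
    have e2 : 3 + i - 1 = 2 + i := by omega
    have e3 : (3 + i) * (4 + j) - 1 = 11 + 4 * i + 3 * j + i * j := by
      have : (3 + i) * (4 + j) = 12 + 4 * i + 3 * j + i * j := by ring
      omega
    rw [e1, e3] at hmin
    rw [e1, e2]
    calc D ^ ((3 + j) * (2 + i)) * (D ^ (4 + j + 1) * h ^ ((3 + i) * (4 + j + 1) + 1))
        = D ^ ((3 + j) * (2 + i) + (4 + j + 1)) * h ^ ((3 + i) * (4 + j + 1) + 1) := by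
          rw [pow_add D]; ring
      _ < D ^ ((3 + i + 1) * (4 + j)) * h ^ ((3 + i) * (4 + j + 1) + 1) := by
          refine Nat.mul_lt_mul_of_pos_right (Nat.pow_lt_pow_right (by omega) ?_)
            (Nat.pow_pos (by omega))
          nlinarith
      _ ≤ h ^ (4 + j) * h ^ ((3 + i) * (4 + j + 1) + 1) := by
          rw [pow_mul D]
          gcongr
      _ = h ^ (4 + j + ((3 + i) * (4 + j + 1) + 1)) := (pow_add _ _ _).symm
      _ ≤ h ^ ((11 + 4 * i + 3 * j + i * j) * (2 + i)) :=
          Nat.pow_le_pow_right (by omega)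
            (by nlinarith [Nat.zero_le (i * j), Nat.zero_le (i * i * j)])
      _ = (h ^ (11 + 4 * i + 3 * j + i * j)) ^ (2 + i) := pow_mul _ _ _
      _ ≤ (D ^ (3 + j) * Y) ^ (2 + i) := Nat.pow_le_pow_left hmin _
      _ = _ := by rw [mul_pow, ← pow_mul]
  refine ⟨r, by omega, fun s hs hs' => ?_⟩
  have hfst : D ^ s * Y < h ^ (n * (s + 1) - 1) := by
    obtain rfl | rfl : s = r ∨ s = r + 1 := by omega
    exacts [hr, hr']
  have hsnd' : D ^ s * h ^ (n * s + 1) < Y ^ (n - 1) := by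
    refine lt_of_le_of_lt ?_ hsnd
    have hh1 : 1 ≤ h := by omega
    gcongr
    omega
  have hCD : 2 * C ^ s ≤ D ^ s := by
    rw [hD, mul_pow]
    exact Nat.mul_le_mul_right _ (Nat.le_self_pow (by omega) 2)
  have hexp : n * (s + 1) - 1 + 1 = n * (s + 1) := by
    have : 1 ≤ n * (s + 1) := Nat.mul_pos (by omega) (by omega)
    omega
  have hA : 2 * C ^ s * Y * (h * Y ^ n) < h ^ (n * (s + 1)) * Y ^ n := by
    calc 2 * C ^ s * Y * (h * Y ^ n) ≤ D ^ s * Y * (h * Y ^ n) := by gcongr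
      _ < h ^ (n * (s + 1) - 1) * (h * Y ^ n) :=
          Nat.mul_lt_mul_of_pos_right hfst (by positivity)
      _ = h ^ (n * (s + 1) - 1 + 1) * Y ^ n := by rw [pow_succ]; ring
      _ = _ := by rw [hexp]
  have hB : 2 * C ^ s * h ^ (n * s + 1) * (h ^ (n * (s + 1)) * Y)
      < h ^ (n * (s + 1)) * Y ^ n := by
    calc 2 * C ^ s * h ^ (n * s + 1) * (h ^ (n * (s + 1)) * Y)
        ≤ D ^ s * h ^ (n * s + 1) * (h ^ (n * (s + 1)) * Y) := by gcongr
      _ < Y ^ (n - 1) * (h ^ (n * (s + 1)) * Y) :=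
          Nat.mul_lt_mul_of_pos_right hsnd' (by positivity)
      _ = h ^ (n * (s + 1)) * Y ^ (n - 1 + 1) := by rw [pow_succ]; ring
      _ = _ := by rw [Nat.sub_add_cancel (by omega)]
  have e : 2 * (C ^ s * (h * Y * (Y ^ n + h ^ (n * (2 * s + 1)))))
      = 2 * C ^ s * Y * (h * Y ^ n) + 2 * C ^ s * h ^ (n * s + 1) * (h ^ (n * (s + 1)) * Y) := by
    rw [show n * (2 * s + 1) = n * s + n * (s + 1) by ring, pow_add, pow_succ h (n * s)]
    ring
  omega

theorem abs_le_of_mul_pow_sub_mul_pow_eq_one {a b x y : ℤ} {n : ℕ} (hb : b ≠ 0) (hn : n ≠ 0)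
    (h : a * x ^ n - b * y ^ n = 1) (hx : 2 ≤ |a * x ^ n|) : |y| ≤ 2 * |a| * |x| := by
  have ha : a ≠ 0 := by rintro rfl; simp at hx
  have hb1 := Int.one_le_abs hb
  have ha1 := Int.one_le_abs ha
  refine (pow_le_pow_iff_left₀ (abs_nonneg _) (by positivity) hn).1 ?_
  calc |y| ^ n ≤ |b| * |y| ^ n := le_mul_of_one_le_left (by positivity) hb1
    _ = |a * x ^ n - 1| := by rw [← abs_pow, ← abs_mul]; congr 1; linarith
    _ ≤ |a * x ^ n| + |1| := abs_sub _ _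
    _ ≤ 2 * |a * x ^ n| := by rw [abs_one]; linarith
    _ = (2 * |a|) * |x| ^ n := by rw [abs_mul, abs_pow]; ring
    _ ≤ (2 * |a|) ^ n * |x| ^ n := by
        gcongr
        exact le_self_pow₀ (by linarith) hn
    _ = _ := (mul_pow _ _ _).symm

theorem pow_mul_two_pow_le {n : ℕ} (hn : n ≠ 0) (r : ℕ) :
    (n : ℝ) ^ (2 * r) * (16 * 2 ^ ((n + 3) * r)) ≤ 16 * (n ^ 2 * 2 ^ (n + 4)) ^ r ∧
      (n : ℝ) ^ (2 * r) * (12 * 16 ^ r) ≤ 16 * (n ^ 2 * 2 ^ (n + 4)) ^ r := by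
  have hn0 : (0 : ℝ) < n := by positivity
  rw [mul_pow, ← pow_mul, ← pow_mul, mul_left_comm (16 : ℝ)]
  have h1 : (2 : ℝ) ^ ((n + 3) * r) ≤ 2 ^ ((n + 4) * r) :=
    pow_le_pow_right₀ (by norm_num) (Nat.mul_le_mul_right _ (by omega))
  have h2 : (16 : ℝ) ^ r ≤ 2 ^ ((n + 4) * r) := by
    rw [show (16 : ℝ) = 2 ^ 4 by norm_num, ← pow_mul]
    exact pow_le_pow_right₀ (by norm_num) (Nat.mul_le_mul_right _ (by omega))
  constructor <;> gcongr
  norm_num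

theorem pow_mul_le_of_one_le {A h Y K : ℝ} {n r : ℕ} (hr : 1 ≤ r) (hA : 1 ≤ A) (hh : 0 < h)
    (hY : 0 < Y) (hK : 0 < K)
    (H : 1 ≤ 32 * A * K ^ r * h * Y *
      (1 / (A * h ^ n) ^ (r + 1) + (A * h ^ n) ^ r / Y ^ n)) :
    h ^ (n * (r + 1)) * Y ^ n
      ≤ (32 * A ^ 2 * K) ^ r * (h * Y * (Y ^ n + h ^ (n * (2 * r + 1)))) := by
  have hA0 : 0 < A := by linarith
  have e1 : 1 / (A * h ^ n) ^ (r + 1) ≤ 1 / h ^ (n * (r + 1)) := by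
    refine one_div_le_one_div_of_le (by positivity) ?_
    rw [pow_mul]
    gcongr
    exact le_mul_of_one_le_left (by positivity) hA
  have e2 : (A * h ^ n) ^ r = A ^ r * h ^ (n * r) := by rw [mul_pow, pow_mul]
  have e3 : 32 * A * A ^ r ≤ (32 * A ^ 2) ^ r := by
    rw [mul_pow, ← pow_mul, mul_assoc, ← pow_succ']
    gcongr
    · exact le_self_pow₀ (by norm_num) (by omega)
    · omega
  have hAr : 1 ≤ A ^ r := one_le_pow₀ hA
  calc h ^ (n * (r + 1)) * Y ^ n = h ^ (n * (r + 1)) * Y ^ n * 1 := (mul_one _).symm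
    _ ≤ h ^ (n * (r + 1)) * Y ^ n * (32 * A * K ^ r * h * Y *
        (A ^ r * (1 / h ^ (n * (r + 1))) + A ^ r * h ^ (n * r) / Y ^ n)) := by
        refine mul_le_mul_of_nonneg_left (H.trans ?_) (by positivity)
        rw [e2]
        gcongr
        exact e1.trans (le_mul_of_one_le_left (by positivity) hAr)
    _ = (32 * A * A ^ r) * K ^ r * (h * Y * (Y ^ n + h ^ (n * r) * h ^ (n * (r + 1)))) := by
        field_simp
    _ ≤ (32 * A ^ 2) ^ r * K ^ r * (h * Y * (Y ^ n + h ^ (n * r) * h ^ (n * (r + 1)))) := by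
        gcongr
    _ = _ := by
        rw [← mul_pow, ← pow_add, show n * r + n * (r + 1) = n * (2 * r + 1) by ring]

theorem pow_mul_le_of_padeForm_ne_zero {a b x₁ y₁ x₂ y₂ : ℤ} {n r : ℕ} (ha : a ≠ 0) (hb : b ≠ 0)
    (hn : 3 ≤ n) (hr : 1 ≤ r) (h₁ : a * x₁ ^ n - b * y₁ ^ n = 1)
    (h₂ : a * x₂ ^ n - b * y₂ ^ n = 1) (hx₁ : 2 ≤ |x₁|) (hx₂ : 2 ≤ |x₂|)
    (hne : padeForm n r ((b * y₁ ^ n : ℤ) / (a * x₁ ^ n : ℤ)) (|x₁ * y₂| : ℤ) (|y₁ * x₂| : ℤ) ≠ 0) :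
    x₁.natAbs ^ (n * (r + 1)) * x₂.natAbs ^ n
      ≤ (32 * a.natAbs ^ 2 * n ^ 2 * 2 ^ (n + 4)) ^ r *
        (x₁.natAbs * x₂.natAbs * (x₂.natAbs ^ n + x₁.natAbs ^ (n * (2 * r + 1)))) := by
  have hn0 : n ≠ 0 := by omega
  have hbig : ∀ x : ℤ, 2 ≤ |x| → 2 ≤ |a * x ^ n| := fun x hx => by
    rw [abs_mul, abs_pow]
    have h1 := Int.one_le_abs ha
    have h2 : |x| ≤ |x| ^ n := le_self_pow₀ (by omega) hn0
    nlinarith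
  have hQ₁ := hbig x₁ hx₁
  have hQ₂ := hbig x₂ hx₂
  obtain ⟨Q₁, hQ₁'⟩ : ∃ Q, Q = a * x₁ ^ n := ⟨_, rfl⟩
  obtain ⟨P₁, hP₁'⟩ : ∃ P, P = b * y₁ ^ n := ⟨_, rfl⟩
  rw [← hQ₁'] at hQ₁ h₁ hne
  rw [← hP₁'] at h₁ hne
  have hQ₁0 : Q₁ ≠ 0 := by rintro rfl; norm_num at hQ₁
  obtain ⟨u, hu, hu', hun, hun2, hu1⟩ := exists_pow_eq_div hn0 (P := (P₁ : ℝ)) (Q := (Q₁ : ℝ))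
    (by exact_mod_cast h₁) (by exact_mod_cast hQ₁)
  obtain ⟨v, hv, -, hvn, -, hv1⟩ := exists_pow_eq_div hn0 (P := ((b * y₂ ^ n : ℤ) : ℝ))
    (Q := ((a * x₂ ^ n : ℤ) : ℝ)) (by exact_mod_cast h₂) (by exact_mod_cast hQ₂)
  set X : ℝ := |(Q₁ : ℝ)| with hX
  set h : ℝ := |(x₁ : ℝ)| with hh
  set Y : ℝ := |(x₂ : ℝ)| with hY
  set A : ℝ := |(a : ℝ)| with hA
  have hh2 : 2 ≤ h := by rw [hh]; exact_mod_cast hx₁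
  have hY2 : 2 ≤ Y := by rw [hY]; exact_mod_cast hx₂
  have hA1 : 1 ≤ A := by rw [hA]; exact_mod_cast Int.one_le_abs ha
  have hXh : X = A * h ^ n := by rw [hX, hQ₁']; push_cast; rw [abs_mul, abs_pow]
  have hQ₂Y : |((a * x₂ ^ n : ℤ) : ℝ)| = A * Y ^ n := by push_cast; rw [abs_mul, abs_pow]
  have hX2 : 2 ≤ X := by rw [hX]; exact_mod_cast hQ₁
  have hX0 : 0 < X := by linarith
  have hh0 : 0 < h := by linarith
  have hY0 : 0 < Y := by linarith
  have hA0 : 0 < A := by linarith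
  have hrel : ((|x₁ * y₂| : ℤ) : ℝ) * u = ((|y₁ * x₂| : ℤ) : ℝ) * v := by
    rw [← pow_left_inj₀ (mul_nonneg (Int.cast_nonneg (abs_nonneg _)) (by linarith))
      (mul_nonneg (Int.cast_nonneg (abs_nonneg _)) (by linarith)) hn0, mul_pow, mul_pow,
      ← abs_of_nonneg (by linarith : 0 ≤ u), ← abs_of_nonneg (by linarith : 0 ≤ v),
      ← abs_pow u, ← abs_pow v, hun, hvn, abs_div, abs_div, hQ₂Y, ← hX, hXh, hP₁']
    push_cast
    simp only [abs_mul, abs_pow]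
    rw [← hh, ← hY]
    field_simp
    ring
  have hy₂ : |(y₂ : ℝ)| ≤ 2 * A * Y := by
    rw [hA, hY]
    exact_mod_cast abs_le_of_mul_pow_sub_mul_pow_eq_one hb hn0 h₂ hQ₂
  have hL := abs_padeForm_le (by omega : 2 ≤ n) r hu hu' hun2 hv
    (Int.cast_nonneg (abs_nonneg _)) hrel hu1 hv1
  rw [hun, hQ₂Y] at hL
  obtain ⟨z, hz⟩ := exists_int_eq_mul_eval_padePoly hn0 1 r (P := P₁) hQ₁0
  obtain ⟨w, hw⟩ := exists_int_eq_mul_eval_padePoly hn0 (-1) r (P := P₁) hQ₁0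
  push_cast at hz hw
  rw [neg_div] at hw
  set L := padeForm n r ((P₁ : ℝ) / Q₁) (|x₁ * y₂| : ℤ) (|y₁ * x₂| : ℤ) with hLdef
  have hint : (n : ℝ) ^ (2 * r) * (Q₁ : ℝ) ^ r * L
      = ((z * |x₁ * y₂| - w * |y₁ * x₂| : ℤ) : ℝ) := by
    rw [Int.cast_sub, Int.cast_mul z, Int.cast_mul w, ← hz, ← hw, hLdef, padeForm]
    ring
  have hone : 1 ≤ (n : ℝ) ^ (2 * r) * X ^ r * |L| := by
    have hne' : (n : ℝ) ^ (2 * r) * (Q₁ : ℝ) ^ r * L ≠ 0 :=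
      mul_ne_zero (mul_ne_zero (pow_ne_zero _ (Nat.cast_ne_zero.2 hn0))
        (pow_ne_zero _ (Int.cast_ne_zero.2 hQ₁0))) hne
    have e : (n : ℝ) ^ (2 * r) * X ^ r * |L| = |(n : ℝ) ^ (2 * r) * (Q₁ : ℝ) ^ r * L| := by
      rw [abs_mul, abs_mul, abs_pow (Q₁ : ℝ), abs_of_nonneg (a := (n : ℝ) ^ (2 * r))
        (by positivity)]
    rw [hint] at hne' e
    rw [e]
    exact_mod_cast Int.one_le_abs (Int.cast_ne_zero.1 hne')
  obtain ⟨K, hK⟩ : ∃ K : ℝ, K = n ^ 2 * 2 ^ (n + 4) := ⟨_, rfl⟩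
  have hα : ((|x₁ * y₂| : ℤ) : ℝ) ≤ h * (2 * A * Y) := by
    push_cast
    rw [abs_mul]
    gcongr
  have hbound : 1 ≤ 32 * A * K ^ r * h * Y * (1 / X ^ (r + 1) + X ^ r / Y ^ n) := by
    obtain ⟨c1, c2⟩ := hK ▸ pow_mul_two_pow_le hn0 r
    have c3 : 1 / (A * Y ^ n) ≤ 1 / Y ^ n :=
      one_div_le_one_div_of_le (by positivity) (le_mul_of_one_le_left (by positivity) hA1)
    calc (1 : ℝ) ≤ (n : ℝ) ^ (2 * r) * X ^ r * |L| := hone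
      _ ≤ (n : ℝ) ^ (2 * r) * X ^ r * (h * (2 * A * Y) *
          ((1 / X) ^ (2 * r + 1) * (16 * 2 ^ ((n + 3) * r)) + 12 * 16 ^ r * (1 / Y ^ n))) := by
          refine mul_le_mul_of_nonneg_left (hL.trans ?_) (by positivity)
          gcongr
      _ = h * (2 * A * Y) * (((n : ℝ) ^ (2 * r) * (16 * 2 ^ ((n + 3) * r))) * (1 / X ^ (r + 1))
          + ((n : ℝ) ^ (2 * r) * (12 * 16 ^ r)) * (X ^ r / Y ^ n)) := by
          have e : X ^ r * (1 / X) ^ (2 * r + 1) = 1 / X ^ (r + 1) := by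
            rw [one_div_pow, show 2 * r + 1 = r + (r + 1) by ring, pow_add]
            field_simp
          rw [← e]; ring
      _ ≤ h * (2 * A * Y) * ((16 * K ^ r) * (1 / X ^ (r + 1)) + (16 * K ^ r) * (X ^ r / Y ^ n)) := by
          gcongr
      _ = _ := by ring
  have hK0 : 0 < K := by rw [hK]; positivity
  have hreal := pow_mul_le_of_one_le hr hA1 hh0 hY0 hK0 (hXh ▸ hbound)
  rw [hK] at hreal
  rw [← Nat.cast_le (α := ℝ)]
  push_cast [Nat.cast_natAbs]
  simp only [← mul_assoc] at hreal ⊢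
  exact hreal

theorem finite_setOf_abs_le {a b : ℤ} (hb : b ≠ 0) {n : ℕ} (hn : n ≠ 0) (H : ℤ) :
    {p : ℤ × ℤ | a * p.1 ^ n - b * p.2 ^ n = 1 ∧ |p.1| ≤ H}.Finite := by
  refine Set.Finite.subset ((Set.finite_Icc (-H) H).prod
    (Set.finite_Icc (-(|a| * H ^ n + 1)) (|a| * H ^ n + 1))) ?_
  rintro ⟨x, y⟩ ⟨h, hx⟩
  refine ⟨abs_le.1 hx, abs_le.1 ?_⟩
  dsimp only at h hx ⊢
  calc |y| ≤ |y| ^ n := by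
        rcases eq_or_ne y 0 with rfl | hy
        · simp [hn]
        · exact le_self_pow₀ (Int.one_le_abs hy) hn
    _ ≤ |b| * |y| ^ n := le_mul_of_one_le_left (by positivity) (Int.one_le_abs hb)
    _ = |a * x ^ n - 1| := by rw [← abs_pow, ← abs_mul]; congr 1; linarith
    _ ≤ |a * x ^ n| + |1| := abs_sub _ _
    _ ≤ _ := by rw [abs_mul, abs_pow, abs_one]; gcongr

/-- Theorem 23: for nonzero integers `a`, `b` and `n ≥ 3`, the
equation `a·xⁿ - b·yⁿ = 1` has only finitely many integer solutions. -/
theorem stmt19 (a b : ℤ) (ha : a ≠ 0) (hb : b ≠ 0) (n : ℕ) (hn : 3 ≤ n) :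
    {p : ℤ × ℤ | a * p.1 ^ n - b * p.2 ^ n = 1}.Finite := by
  have hn0 : n ≠ 0 := by omega
  obtain ⟨C, hC⟩ : ∃ C, C = 32 * a.natAbs ^ 2 * n ^ 2 * 2 ^ (n + 4) := ⟨_, rfl⟩
  have hC1 : 1 ≤ C := by
    have : 0 < a.natAbs := Int.natAbs_pos.2 ha
    rw [hC]
    exact Nat.succ_le_of_lt (by positivity)
  by_cases hbd : ∀ p ∈ {p : ℤ × ℤ | a * p.1 ^ n - b * p.2 ^ n = 1},
      |p.1| ≤ ((2 * C) ^ (n + 1) : ℕ)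
  · exact (finite_setOf_abs_le hb hn0 _).subset fun p hp => ⟨hp, hbd p hp⟩
  push Not at hbd
  obtain ⟨⟨x₁, y₁⟩, h₁, hx₁⟩ := hbd
  simp only [Set.mem_ofPred_eq] at h₁ hx₁
  have hh : (2 * C) ^ (n + 1) ≤ x₁.natAbs := by
    rw [Int.abs_eq_natAbs] at hx₁
    exact_mod_cast hx₁.le
  have hh2 : 2 ≤ x₁.natAbs :=
    le_trans (by omega) ((Nat.le_self_pow (by omega) (2 * C)).trans hh)
  refine (finite_setOf_abs_le hb hn0 ((x₁.natAbs ^ (4 * n) : ℕ) : ℤ)).subset fun p h₂ => ⟨h₂, ?_⟩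
  obtain ⟨x₂, y₂⟩ := p
  simp only [Set.mem_ofPred_eq] at h₂ ⊢
  by_contra! hlt
  rw [Int.abs_eq_natAbs, Nat.cast_lt] at hlt
  have hY2 : 2 ≤ x₂.natAbs := hh2.trans ((Nat.le_self_pow (by omega) _).trans hlt.le)
  obtain ⟨r, hr, H⟩ := exists_pade_order hn hC1 hh hlt.le
  have habs₁ : 2 ≤ |x₁| := by rw [Int.abs_eq_natAbs]; exact_mod_cast hh2
  have habs₂ : 2 ≤ |x₂| := by rw [Int.abs_eq_natAbs]; exact_mod_cast hY2
  have hzero : ∀ s, r ≤ s → s ≤ r + 1 →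
      padeForm n s ((b * y₁ ^ n : ℤ) / (a * x₁ ^ n : ℤ)) (|x₁ * y₂| : ℤ) (|y₁ * x₂| : ℤ) = 0 := by
    intro s hs hs'
    by_contra hne
    have h := pow_mul_le_of_padeForm_ne_zero ha hb hn (hr.trans hs) h₁ h₂ habs₁ habs₂ hne
    rw [← hC] at h
    exact absurd h (not_le.2 (H s hs hs'))
  have hx₁0 : x₁ ≠ 0 := by rintro rfl; norm_num at habs₁
  have hy₂0 : y₂ ≠ 0 := by
    rintro rfl
    rw [zero_pow hn0, mul_zero, sub_zero] at h₂
    have : IsUnit x₂ := (isUnit_pow_iff hn0).1 (IsUnit.of_mul_eq_one_right a h₂)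
    have := Int.isUnit_iff_natAbs_eq.1 this
    omega
  have ht : ((b * y₁ ^ n : ℤ) / (a * x₁ ^ n : ℤ) : ℝ) ≠ 1 := by
    intro h
    have := eq_of_div_eq_one h
    rw [Int.cast_inj] at this
    omega
  rcases padeForm_ne_zero_or (by omega : 2 ≤ n) r (β := (|y₁ * x₂| : ℤ)) ht
    (Int.cast_ne_zero.2 (abs_ne_zero.2 (mul_ne_zero hx₁0 hy₂0))) with h | h
  · exact h (hzero r le_rfl (Nat.le_succ r))
  · exact h (hzero (r + 1) (Nat.le_succ r) le_rfl)
end
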